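/- Let b ≥ 2 be an integer and let μ be a non-atomic self-similar measure on ℝ associated to a self-similar IFS {f_i(x) = s_i·x + t_i}_{i=1}^n and a strictly positive probability vector. Suppose there is some i such that log|s_i| / log b is irrational. Then for every C¹ diffeomorphism g : ℝ → ℝ (g bijective, continuously differentiable with continuously differentiable inverse), the pushforward measure g_*μ gives full measure to the set of numbers normal in base b; equivalently, for μ-almost every x the number g(x) is normal in base b. -/

import Mathlib

open MeasureTheory Filter Topology

/-- The additive character `x ↦ exp (2πix)` of `ℝ`. -/
noncomputable def unitChar (x : ℝ) : ℂ := Complex.exp ((2 * Real.pi * x : ℝ) * Complex.I)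

lemma norm_unitChar (x : ℝ) : ‖unitChar x‖ = 1 := Complex.norm_exp_ofReal_mul_I _

lemma unitChar_add (x y : ℝ) : unitChar (x + y) = unitChar x * unitChar y := by
  simp only [unitChar, ← Complex.exp_add]
  congr 1
  push_cast
  ring

lemma unitChar_zero : unitChar 0 = 1 := by simp [unitChar]

@[fun_prop]
lemma continuous_unitChar : Continuous unitChar := by
  unfold unitChar
  fun_prop

lemma norm_unitChar_sub_le (x y : ℝ) : ‖unitChar x - unitChar y‖ ≤ 2 * Real.pi * |x - y| := by
  have h : unitChar x - unitChar y = unitChar y * (unitChar (x - y) - 1) := by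
    rw [mul_sub, ← unitChar_add]
    simp
  have h2 := Real.norm_exp_I_mul_ofReal_sub_one_le (x := 2 * Real.pi * (x - y))
  rw [h, norm_mul, norm_unitChar, one_mul, unitChar, mul_comm _ Complex.I]
  refine h2.trans (le_of_eq ?_)
  rw [Real.norm_eq_abs, abs_mul, abs_of_pos (by positivity)]

lemma fourier_coe_eq_unitChar (m : ℤ) (x : ℝ) :
    fourier m (x : UnitAddCircle) = unitChar (m * x) := by
  rw [fourier_coe_apply, unitChar]
  congr 1
  push_cast
  ring

lemma norm_average_le {N : ℕ} {x : ℕ → ℂ} {C : ℝ} (hC : 0 ≤ C) (hx : ∀ k, ‖x k‖ ≤ C) :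
    ‖(N : ℂ)⁻¹ * ∑ k ∈ Finset.range N, x k‖ ≤ C := by
  rcases Nat.eq_zero_or_pos N with rfl | hN
  · simpa using hC
  have hN' : (0 : ℝ) < N := by exact_mod_cast hN
  rw [norm_mul, norm_inv, Complex.norm_natCast, inv_mul_le_iff₀ hN']
  calc _ ≤ ∑ k ∈ Finset.range N, ‖x k‖ := norm_sum_le _ _
    _ ≤ ∑ k ∈ Finset.range N, C := Finset.sum_le_sum fun k _ => hx k
    _ = N * C := by simp

/-- **Weyl's criterion** for continuous functions on the circle. -/
lemma tendsto_average_circle_of_unitChar {θ : ℕ → ℝ}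
    (h : ∀ m : ℤ, m ≠ 0 → Tendsto
      (fun N : ℕ => (N : ℂ)⁻¹ * ∑ k ∈ Finset.range N, unitChar (m * θ k)) atTop (𝓝 0))
    (F : C(UnitAddCircle, ℂ)) :
    Tendsto (fun N : ℕ => (N : ℂ)⁻¹ * ∑ k ∈ Finset.range N, F (θ k : UnitAddCircle)) atTop
      (𝓝 (∫ x, F x)) := by
  have hint (G : C(UnitAddCircle, ℂ)) : Integrable (fun x => G x) :=
    G.continuous.integrable_of_hasCompactSupport (HasCompactSupport.of_compactSpace _)
  have hspan : ∀ G ∈ Submodule.span ℂ (Set.range (@fourier (1 : ℝ))),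
      Tendsto (fun N : ℕ => (N : ℂ)⁻¹ * ∑ k ∈ Finset.range N, G (θ k : UnitAddCircle)) atTop
      (𝓝 (∫ x, G x)) := by
    intro G hG
    induction hG using Submodule.span_induction with
    | mem G hG =>
      obtain ⟨m, rfl⟩ := hG
      simp only [fourier_coe_eq_unitChar]
      by_cases hm : m = 0
      · subst hm
        have : ∫ x : UnitAddCircle, (fourier 0 x : ℂ) = 1 := by
          simp only [fourier_zero]
          simp [Measure.real]
        rw [this]
        refine tendsto_const_nhds.congr' ?_
        filter_upwards [eventually_gt_atTop 0] with N hN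
        have : (N : ℂ) ≠ 0 := by exact_mod_cast hN.ne'
        simp [unitChar_zero, this]
      · have : ∫ x : UnitAddCircle, (fourier m x : ℂ) = 0 := by
          have h1 := congrFun (fourierCoeff_fourier (T := (1 : ℝ)) m) 0
          rw [Pi.single_apply, if_neg (Ne.symm hm), fourierCoeff] at h1
          simp only [neg_zero, fourier_zero, one_smul] at h1
          rw [← h1, AddCircle.volume_eq_smul_haarAddCircle]
          simp
        rw [this]
        exact h m hm
    | zero => simp
    | add G H _ _ hG hH =>
      simp only [ContinuousMap.add_apply, Finset.sum_add_distrib, mul_add]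
      rw [integral_add (hint G) (hint H)]
      exact hG.add hH
    | smul c G _ hG =>
      simp only [ContinuousMap.smul_apply, smul_eq_mul, ← Finset.mul_sum]
      rw [integral_const_mul]
      refine (hG.const_mul c).congr fun N => ?_
      ring
  have hF : F ∈ (Submodule.span ℂ (Set.range (@fourier (1 : ℝ)))).topologicalClosure := by
    rw [span_fourier_closure_eq_top]
    trivial
  have hF' : F ∈ closure (Submodule.span ℂ (Set.range (@fourier (1 : ℝ))) :
    Set C(UnitAddCircle, ℂ)) := hF
  rw [Metric.mem_closure_iff] at hF'
  rw [Metric.tendsto_atTop]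
  intro ε hε
  obtain ⟨G, hG, hFG⟩ := hF' (ε / 3) (by positivity)
  obtain ⟨N₀, hN₀⟩ := Metric.tendsto_atTop.1 (hspan G hG) (ε / 3) (by positivity)
  have hpt : ∀ x, ‖F x - G x‖ ≤ ε / 3 := fun x => by
    rw [← dist_eq_norm]
    exact (ContinuousMap.dist_apply_le_dist x).trans hFG.le
  refine ⟨N₀, fun N hN => ?_⟩
  have h1 : ‖(N : ℂ)⁻¹ * ∑ k ∈ Finset.range N, (F (θ k) - G (θ k))‖ ≤ ε / 3 :=
    norm_average_le (by positivity) fun k => hpt _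
  have h2 : ‖∫ x, (F x - G x)‖ ≤ ε / 3 := by
    refine (norm_integral_le_of_norm_le_const (C := ε / 3) (ae_of_all _ hpt)).trans ?_
    simp [Measure.real]
  rw [integral_sub (hint F) (hint G)] at h2
  rw [Finset.sum_sub_distrib, mul_sub] at h1
  have h3 := hN₀ N hN
  rw [dist_eq_norm] at h3 ⊢
  set a := (N : ℂ)⁻¹ * ∑ k ∈ Finset.range N, F (θ k)
  set c := (N : ℂ)⁻¹ * ∑ k ∈ Finset.range N, G (θ k)
  calc ‖a - ∫ x, F x‖ = ‖(a - c) + (c - ∫ x, G x) - ((∫ x, F x) - ∫ x, G x)‖ := by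
        congr 1; ring
    _ ≤ ‖a - c‖ + ‖c - ∫ x, G x‖ + ‖(∫ x, F x) - ∫ x, G x‖ :=
        (norm_sub_le _ _).trans (by gcongr; exact norm_add_le _ _)
    _ < ε := by linarith

/-- Weyl's criterion for continuous functions on `[0, 1]` with equal values at the end points. -/
lemma tendsto_average_fract_of_eq {θ : ℕ → ℝ}
    (h : ∀ m : ℤ, m ≠ 0 → Tendsto
      (fun N : ℕ => (N : ℂ)⁻¹ * ∑ k ∈ Finset.range N, unitChar (m * θ k)) atTop (𝓝 0))
    {f : ℝ → ℝ} (hf : Continuous f) (h01 : f 0 = f 1) :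
    Tendsto (fun N : ℕ => (N : ℝ)⁻¹ * ∑ k ∈ Finset.range N, f (Int.fract (θ k))) atTop
      (𝓝 (∫ y in (0 : ℝ)..1, f y)) := by
  let fc : ℝ → ℂ := fun x => f x
  have hfc : Continuous fc := by fun_prop
  let F : C(UnitAddCircle, ℂ) := ⟨AddCircle.liftIco 1 0 fc,
    AddCircle.liftIco_zero_continuous (by simp [fc, h01]) hfc.continuousOn⟩
  have hF : ∀ x : ℝ, F (x : UnitAddCircle) = f (Int.fract x) := by
    intro x
    have hx : (x : UnitAddCircle) = ((Int.fract x : ℝ) : UnitAddCircle) := by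
      rw [Int.fract, AddCircle.coe_sub]
      have : (((⌊x⌋ : ℤ) : ℝ) : UnitAddCircle) = 0 := by
        rw [AddCircle.coe_eq_zero_iff]
        exact ⟨⌊x⌋, by simp⟩
      rw [this, sub_zero]
    rw [hx]
    exact AddCircle.liftIco_zero_coe_apply (f := fc) ⟨Int.fract_nonneg x, Int.fract_lt_one x⟩
  have hI : ∫ x, F x = ((∫ y in (0 : ℝ)..1, f y : ℝ) : ℂ) := by
    rw [← UnitAddCircle.intervalIntegral_preimage 0 (fun x => F x),
      ← intervalIntegral.integral_ofReal, zero_add]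
    refine intervalIntegral.integral_congr_ae ?_
    have : ∀ᵐ x : ℝ, x ≠ 1 := by simp [ae_iff, measure_singleton]
    filter_upwards [this] with x hx1 hx
    rw [Set.uIoc_of_le zero_le_one] at hx
    rw [hF, Int.fract_eq_self.2 ⟨hx.1.le, lt_of_le_of_ne hx.2 hx1⟩]
  have := tendsto_average_circle_of_unitChar h F
  rw [hI] at this
  simp only [hF] at this
  refine (Complex.continuous_re.continuousAt.tendsto.comp this).congr fun N => ?_
  have hN : (N : ℂ)⁻¹ * ∑ k ∈ Finset.range N, ((f (Int.fract (θ k)) : ℝ) : ℂ)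
      = (((N : ℝ)⁻¹ * ∑ k ∈ Finset.range N, f (Int.fract (θ k)) : ℝ) : ℂ) := by
    push_cast
    rfl
  rw [Function.comp, hN, Complex.ofReal_re]

/-- **Weyl's criterion** for continuous functions on `[0, 1]`. -/
lemma tendsto_average_fract {θ : ℕ → ℝ}
    (h : ∀ m : ℤ, m ≠ 0 → Tendsto
      (fun N : ℕ => (N : ℂ)⁻¹ * ∑ k ∈ Finset.range N, unitChar (m * θ k)) atTop (𝓝 0))
    {f : ℝ → ℝ} (hf : Continuous f) :
    Tendsto (fun N : ℕ => (N : ℝ)⁻¹ * ∑ k ∈ Finset.range N, f (Int.fract (θ k))) atTop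
      (𝓝 (∫ y in (0 : ℝ)..1, f y)) := by
  have hid : Tendsto (fun N : ℕ => (N : ℝ)⁻¹ * ∑ k ∈ Finset.range N, Int.fract (θ k)) atTop
      (𝓝 (∫ y in (0 : ℝ)..1, y)) := by
    have key : ∀ δ : ℝ, 0 < δ → δ ≤ 1 → ∃ u v : ℝ → ℝ, Continuous u ∧ Continuous v ∧
        u 0 = u 1 ∧ v 0 = v 1 ∧ (∀ x ∈ Set.Icc (0 : ℝ) 1, u x ≤ x ∧ x ≤ v x) ∧
        (∫ y in (0 : ℝ)..1, y) - δ ≤ (∫ y in (0 : ℝ)..1, u y) ∧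
        (∫ y in (0 : ℝ)..1, v y) ≤ (∫ y in (0 : ℝ)..1, y) + δ := by
      intro δ hδ hδ1
      have hw : Continuous fun x : ℝ => max 0 (1 - x / δ) := by fun_prop
      have hw' : Continuous fun x : ℝ => max 0 (1 - (1 - x) / δ) := by fun_prop
      have hIw : ∫ y in (0 : ℝ)..1, max 0 (1 - y / δ) ≤ δ := by
        rw [← intervalIntegral.integral_add_adjacent_intervals (b := δ)
          (hw.intervalIntegrable _ _) (hw.intervalIntegrable _ _)]
        have h1 : ∫ y in (0 : ℝ)..δ, max 0 (1 - y / δ) ≤ ∫ y in (0 : ℝ)..δ, (1 : ℝ) := by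
          refine intervalIntegral.integral_mono_on hδ.le (hw.intervalIntegrable _ _)
            (by simp) fun x hx => ?_
          have : 0 ≤ x / δ := div_nonneg hx.1 hδ.le
          exact max_le zero_le_one (by linarith)
        have h2 : ∫ y in δ..(1 : ℝ), max 0 (1 - y / δ) = ∫ y in δ..(1 : ℝ), (0 : ℝ) := by
          refine intervalIntegral.integral_congr fun x hx => ?_
          rw [Set.uIcc_of_le hδ1] at hx
          have : 1 ≤ x / δ := (one_le_div hδ).2 hx.1
          exact max_eq_left (by linarith)
        rw [h2]
        simpa using h1
      have hIw' : ∫ y in (0 : ℝ)..1, max 0 (1 - (1 - y) / δ) ≤ δ := by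
        rw [intervalIntegral.integral_comp_sub_left (fun y => max 0 (1 - y / δ)) 1]
        simpa using hIw
      have h1δ : max 0 (1 - 1 / δ) = 0 :=
        max_eq_left (by linarith [(one_le_div hδ).2 hδ1])
      refine ⟨fun x => x - max 0 (1 - (1 - x) / δ), fun x => x + max 0 (1 - x / δ),
        by fun_prop, by fun_prop, ?_, ?_, fun x hx => ⟨?_, ?_⟩, ?_, ?_⟩
      · simp only [sub_zero, h1δ]
        simp
      · simp only [h1δ]
        simp
      · have := le_max_left 0 (1 - (1 - x) / δ)
        dsimp only
        linarith
      · have := le_max_left 0 (1 - x / δ)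
        dsimp only
        linarith
      · dsimp only
        rw [intervalIntegral.integral_sub (continuous_id'.intervalIntegrable _ _)
          (hw'.intervalIntegrable _ _)]
        linarith
      · dsimp only
        rw [intervalIntegral.integral_add (continuous_id'.intervalIntegrable _ _)
          (hw.intervalIntegrable _ _)]
        linarith
    rw [Metric.tendsto_atTop]
    intro ε hε
    obtain ⟨u, v, hu, hv, hu01, hv01, huv, hIu, hIv⟩ :=
      key (min 1 (ε / 2)) (by positivity) (min_le_left _ _)
    have hmin := min_le_right 1 (ε / 2)
    obtain ⟨N₁, hN₁⟩ := Metric.tendsto_atTop.1 (tendsto_average_fract_of_eq h hu hu01) (ε / 2)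
      (by positivity)
    obtain ⟨N₂, hN₂⟩ := Metric.tendsto_atTop.1 (tendsto_average_fract_of_eq h hv hv01) (ε / 2)
      (by positivity)
    refine ⟨max N₁ N₂, fun N hN => ?_⟩
    have h1 := hN₁ N (le_of_max_le_left hN)
    have h2 := hN₂ N (le_of_max_le_right hN)
    have hfr : ∀ k, Int.fract (θ k) ∈ Set.Icc (0 : ℝ) 1 := fun k =>
      ⟨Int.fract_nonneg _, (Int.fract_lt_one _).le⟩
    have h3 : (N : ℝ)⁻¹ * ∑ k ∈ Finset.range N, u (Int.fract (θ k))
        ≤ (N : ℝ)⁻¹ * ∑ k ∈ Finset.range N, Int.fract (θ k) := by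
      gcongr with k _
      exact (huv _ (hfr k)).1
    have h4 : (N : ℝ)⁻¹ * ∑ k ∈ Finset.range N, Int.fract (θ k)
        ≤ (N : ℝ)⁻¹ * ∑ k ∈ Finset.range N, v (Int.fract (θ k)) := by
      gcongr with k _
      exact (huv _ (hfr k)).2
    rw [Real.dist_eq, abs_lt] at h1 h2 ⊢
    constructor <;> linarith [h1.1, h1.2, h2.1, h2.2]
  have hper := tendsto_average_fract_of_eq h (f := fun x => f x - (f 1 - f 0) * x)
    (by fun_prop) (by simp)
  have hsum := hper.add (hid.const_mul (f 1 - f 0))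
  rw [intervalIntegral.integral_sub (hf.intervalIntegrable _ _)
    ((by fun_prop : Continuous fun x : ℝ => (f 1 - f 0) * x).intervalIntegrable _ _),
    intervalIntegral.integral_const_mul, sub_add_cancel] at hsum
  refine hsum.congr fun N => ?_
  rw [Finset.sum_sub_distrib, ← Finset.mul_sum]
  ring

lemma tendsto_average_of_tendsto_average_sq {z : ℕ → ℂ} {C : ℝ} (hz : ∀ n, ‖z n‖ ≤ C)
    (h : Tendsto (fun j : ℕ => ‖∑ k ∈ Finset.range (j ^ 2), z k‖ / (j : ℝ) ^ 2) atTop (𝓝 0)) :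
    Tendsto (fun N : ℕ => (N : ℂ)⁻¹ * ∑ k ∈ Finset.range N, z k) atTop (𝓝 0) := by
  have hC : 0 ≤ C := (norm_nonneg _).trans (hz 0)
  have hsqrt : Tendsto Nat.sqrt atTop atTop := by
    refine tendsto_atTop.2 fun b => ?_
    filter_upwards [eventually_ge_atTop (b * b)] with N hN
    exact Nat.le_sqrt.2 hN
  have h1 : Tendsto (fun j : ℕ => ‖∑ k ∈ Finset.range (j ^ 2), z k‖ / (j : ℝ) ^ 2
      + 2 * C / j) atTop (𝓝 0) := by
    simpa using h.add (tendsto_const_div_atTop_nhds_zero_nat (2 * C))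
  refine squeeze_zero_norm' ?_ (h1.comp hsqrt)
  filter_upwards [eventually_gt_atTop 0] with N hN
  set j := Nat.sqrt N with hj
  have hj0 : 0 < j := Nat.sqrt_pos.2 hN
  have hjN : j ^ 2 ≤ N := Nat.sqrt_le' N
  have hNj : N ≤ j ^ 2 + 2 * j := by
    have := Nat.sqrt_le_add N
    rw [← hj] at this
    nlinarith
  have hsum : ‖∑ k ∈ Finset.range N, z k‖ ≤ ‖∑ k ∈ Finset.range (j ^ 2), z k‖ + 2 * C * j := by
    rw [← Finset.sum_range_add_sum_Ico z hjN]
    refine (norm_add_le _ _).trans (add_le_add_right ?_ _)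
    calc _ ≤ ∑ k ∈ Finset.Ico (j ^ 2) N, C := norm_sum_le_of_le _ fun k _ => hz k
      _ = ((N - j ^ 2 : ℕ) : ℝ) * C := by simp
      _ ≤ ((2 * j : ℕ) : ℝ) * C := by
        gcongr
        omega
      _ = 2 * C * j := by push_cast; ring
  have hj0' : (0 : ℝ) < j := by exact_mod_cast hj0
  have hN' : (0 : ℝ) < N := by exact_mod_cast hN
  have hjN' : (j : ℝ) ^ 2 ≤ N := by exact_mod_cast hjN
  rw [norm_mul, norm_inv, Complex.norm_natCast, inv_mul_le_iff₀ hN']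
  simp only [Function.comp]
  refine hsum.trans ?_
  have : ‖∑ k ∈ Finset.range (j ^ 2), z k‖ + 2 * C * j
      = (j : ℝ) ^ 2 * (‖∑ k ∈ Finset.range (j ^ 2), z k‖ / (j : ℝ) ^ 2 + 2 * C / j) := by
    field_simp
  rw [this]
  gcongr

open ComplexConjugate in
/-- A strong law of large numbers for bounded random variables with summable correlations. -/
lemma ae_tendsto_average_of_correlation {Ω : Type*} [MeasurableSpace Ω] {P : Measure Ω}
    [IsProbabilityMeasure P] {Z : ℕ → Ω → ℂ} (hZ : ∀ n, Measurable (Z n)) {C : ℝ}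
    (hC : ∀ n ω, ‖Z n ω‖ ≤ C) {a : ℕ → ℝ} (ha : Summable a)
    (hcorr : ∀ n k, ‖∫ ω, Z n ω * conj (Z (n + k) ω) ∂P‖ ≤ a k) :
    ∀ᵐ ω ∂P, Tendsto (fun N : ℕ => (N : ℂ)⁻¹ * ∑ k ∈ Finset.range N, Z k ω) atTop (𝓝 0) := by
  have ha0 : ∀ k, 0 ≤ a k := fun k => (norm_nonneg _).trans (hcorr 0 k)
  have hconj : Measurable (conj : ℂ → ℂ) := Complex.continuous_conj.measurable
  have hint (n m : ℕ) : Integrable (fun ω => Z n ω * conj (Z m ω)) P := by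
    refine Integrable.of_bound (C := C * C)
      ((hZ n).mul (hconj.comp (hZ m))).aestronglyMeasurable (ae_of_all _ fun ω => ?_)
    rw [norm_mul, RCLike.norm_conj]
    exact mul_le_mul (hC n ω) (hC m ω) (norm_nonneg _) ((norm_nonneg _).trans (hC n ω))
  have hSm (N : ℕ) : Measurable fun ω => ∑ k ∈ Finset.range N, Z k ω :=
    Finset.measurable_sum _ fun k _ => hZ k
  have hSint (N : ℕ) : Integrable (fun ω => ‖∑ k ∈ Finset.range N, Z k ω‖ ^ 2) P := by
    refine Integrable.of_bound (C := (N * C) ^ 2)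
      ((hSm N).norm.pow_const 2).aestronglyMeasurable (ae_of_all _ fun ω => ?_)
    rw [norm_pow, norm_norm]
    gcongr
    calc _ ≤ ∑ k ∈ Finset.range N, C := norm_sum_le_of_le _ fun k _ => hC k ω
      _ = N * C := by simp
  have hvar : ∀ N : ℕ, ∫ ω, ‖∑ k ∈ Finset.range N, Z k ω‖ ^ 2 ∂P ≤ 2 * (∑' k, a k) * N := by
    intro N
    induction N with
    | zero => simp
    | succ N ih =>
      have hexp : ∀ ω, ‖∑ k ∈ Finset.range (N + 1), Z k ω‖ ^ 2
          = ‖∑ k ∈ Finset.range N, Z k ω‖ ^ 2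
            + (2 * ∑ k ∈ Finset.range N, Z k ω * conj (Z N ω) + Z N ω * conj (Z N ω)).re := by
        intro ω
        rw [Finset.sum_range_succ, ← Finset.sum_mul, ← Complex.normSq_eq_norm_sq,
          ← Complex.normSq_eq_norm_sq, Complex.normSq_add, Complex.mul_conj]
        simp
        ring
      have hi1 : Integrable (fun ω => 2 * ∑ k ∈ Finset.range N, Z k ω * conj (Z N ω)) P :=
        (integrable_finsetSum _ fun k _ => hint k N).const_mul 2
      have hi2 : Integrable (fun ω => 2 * ∑ k ∈ Finset.range N, Z k ω * conj (Z N ω)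
          + Z N ω * conj (Z N ω)) P := hi1.add (hint N N)
      have hi3 : Integrable (fun ω => (2 * ∑ k ∈ Finset.range N, Z k ω * conj (Z N ω)
          + Z N ω * conj (Z N ω)).re) P := hi2.re
      simp_rw [hexp]
      rw [integral_add (hSint N) hi3]
      have hre : ∫ ω, (2 * ∑ k ∈ Finset.range N, Z k ω * conj (Z N ω)
          + Z N ω * conj (Z N ω)).re ∂P
          = (∫ ω, (2 * ∑ k ∈ Finset.range N, Z k ω * conj (Z N ω)
          + Z N ω * conj (Z N ω)) ∂P).re := integral_re hi2
      rw [hre, integral_add hi1 (hint N N), integral_const_mul,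
        integral_finsetSum _ fun k _ => hint k N]
      have hb : ‖2 * ∑ k ∈ Finset.range N, ∫ ω, Z k ω * conj (Z N ω) ∂P
          + ∫ ω, Z N ω * conj (Z N ω) ∂P‖ ≤ 2 * ∑' k, a k := by
        have hN0 := hcorr N 0
        rw [add_zero] at hN0
        have h1 : ‖∑ k ∈ Finset.range N, ∫ ω, Z k ω * conj (Z N ω) ∂P‖
            ≤ ∑ k ∈ Finset.range N, a (k + 1) := by
          rw [← Finset.sum_range_reflect (fun k => a (k + 1)) N]
          refine norm_sum_le_of_le _ fun k hk => ?_
          have hk' := Finset.mem_range.1 hk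
          have := hcorr k (N - k)
          rw [Nat.add_sub_cancel' hk'.le] at this
          rwa [show N - 1 - k + 1 = N - k by omega]
        have h2 : ∑ k ∈ Finset.range N, a (k + 1) + a 0 ≤ ∑' k, a k := by
          rw [← Finset.sum_range_succ']
          exact ha.sum_le_tsum _ fun k _ => ha0 k
        refine (norm_add_le _ _).trans ?_
        rw [norm_mul, Complex.norm_ofNat]
        linarith [ha0 0]
      have := (Complex.re_le_norm _).trans hb
      push_cast
      linarith
  have hlin (j : ℕ) : ∫⁻ ω, ENNReal.ofReal ((‖∑ k ∈ Finset.range (j ^ 2), Z k ω‖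
      / (j : ℝ) ^ 2) ^ 2) ∂P ≤ ENNReal.ofReal (2 * (∑' k, a k) * (1 / (j : ℝ) ^ 2)) := by
    rw [← ofReal_integral_eq_lintegral_ofReal]
    · refine ENNReal.ofReal_le_ofReal ?_
      simp_rw [div_pow]
      rw [integral_div]
      rcases Nat.eq_zero_or_pos j with rfl | hj
      · simp
      have hj' : (0 : ℝ) < j := by exact_mod_cast hj
      rw [div_le_iff₀ (by positivity)]
      refine (hvar _).trans (le_of_eq ?_)
      push_cast
      field_simp
    · simp_rw [div_pow]
      exact (hSint _).div_const _
    · exact ae_of_all _ fun ω => by positivity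
  have hfin : ∫⁻ ω, ∑' j : ℕ, ENNReal.ofReal ((‖∑ k ∈ Finset.range (j ^ 2), Z k ω‖
      / (j : ℝ) ^ 2) ^ 2) ∂P ≠ ⊤ := by
    rw [lintegral_tsum fun j => (((hSm _).norm.div_const _).pow_const 2).ennreal_ofReal.aemeasurable]
    refine ne_top_of_le_ne_top ?_ (ENNReal.tsum_le_tsum hlin)
    exact ((Real.summable_one_div_nat_pow.2 one_lt_two).mul_left _).tsum_ofReal_ne_top
  filter_upwards [ae_lt_top (Measurable.tsum fun j =>
    (((hSm _).norm.div_const _).pow_const 2).ennreal_ofReal) hfin] with ω hω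
  refine tendsto_average_of_tendsto_average_sq (fun n => hC n ω) ?_
  have h1 := ENNReal.tendsto_atTop_zero_of_tsum_ne_top hω.ne
  have h2 := (ENNReal.tendsto_toReal ENNReal.zero_ne_top).comp h1
  have h3 : Tendsto (fun j : ℕ => (‖∑ k ∈ Finset.range (j ^ 2), Z k ω‖ / (j : ℝ) ^ 2) ^ 2)
      atTop (𝓝 0) := by
    refine h2.congr fun j => ?_
    simp only [Function.comp]
    rw [ENNReal.toReal_ofReal (by positivity)]
  have h4 := (Real.continuous_sqrt.tendsto 0).comp h3
  rw [Real.sqrt_zero] at h4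
  refine h4.congr fun j => ?_
  simp only [Function.comp]
  rw [Real.sqrt_sq (by positivity)]

/-- The sequence whose first `m` terms are those of `ω₀`, followed by the terms of `ω`. -/
def glue {ι : Type*} (m : ℕ) (ω₀ ω : ℕ → ι) : ℕ → ι :=
  fun k => if k < m then ω₀ k else ω (k - m)

section Glue

variable {ι : Type*}

lemma glue_of_lt {m k : ℕ} (h : k < m) (ω₀ ω : ℕ → ι) : glue m ω₀ ω k = ω₀ k := if_pos h

lemma glue_add (m k : ℕ) (ω₀ ω : ℕ → ι) : glue m ω₀ ω (m + k) = ω k := by simp [glue]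

lemma glue_shift (m : ℕ) (ω : ℕ → ι) : glue m ω (fun k => ω (m + k)) = ω := by
  ext k
  by_cases h : k < m
  · exact glue_of_lt h _ _
  · simp [glue, h, Nat.add_sub_cancel' (not_lt.1 h)]

variable [MeasurableSpace ι]

lemma measurable_glue (m : ℕ) :
    Measurable fun q : (ℕ → ι) × (ℕ → ι) => glue m q.1 q.2 := by
  refine measurable_pi_lambda _ fun k => ?_
  by_cases h : k < m
  · simp only [glue, h, if_true]
    fun_prop
  · simp only [glue, h, if_false]
    fun_prop

variable (ν : Measure ι) [IsProbabilityMeasure ν]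

lemma map_glue (m : ℕ) :
    Measure.map (fun q : (ℕ → ι) × (ℕ → ι) => glue m q.1 q.2)
      ((Measure.infinitePi fun _ : ℕ => ν).prod (Measure.infinitePi fun _ : ℕ => ν))
      = Measure.infinitePi fun _ : ℕ => ν := by
  refine Measure.eq_infinitePi (X := fun _ : ℕ => ι) (μ := fun _ => ν) fun s t ht => ?_
  have hpre : (fun q : (ℕ → ι) × (ℕ → ι) => glue m q.1 q.2) ⁻¹' (Set.pi (s : Set ℕ) t)
      = (Set.pi ((s.filter (· < m) : Finset ℕ) : Set ℕ) t) ×ˢ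
        (Set.pi (((s.filter (¬ · < m)).image (· - m) : Finset ℕ) : Set ℕ)
          fun k => t (m + k)) := by
    ext ⟨ω₀, ω⟩
    simp only [Set.mem_preimage, Set.mem_pi, Set.mem_prod, Finset.mem_coe, Finset.mem_filter,
      Finset.mem_image]
    constructor
    · refine fun h => ⟨fun k hk => ?_, ?_⟩
      · simpa [glue, hk.2] using h k hk.1
      · rintro _ ⟨k, hk, rfl⟩
        have := h k hk.1
        simpa [glue, hk.2, Nat.add_sub_cancel' (not_lt.1 hk.2)] using this
    · rintro ⟨h1, h2⟩ k hk
      by_cases hkm : k < m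
      · simpa [glue, hkm] using h1 k ⟨hk, hkm⟩
      · have := h2 (k - m) ⟨k, ⟨hk, hkm⟩, rfl⟩
        simpa [glue, hkm, Nat.add_sub_cancel' (not_lt.1 hkm)] using this
  rw [Measure.map_apply (measurable_glue m)
    (MeasurableSet.pi s.countable_toSet fun i _ => ht i), hpre, Measure.prod_prod,
    Measure.infinitePi_pi (fun _ : ℕ => ν) fun i _ => ht i,
    Measure.infinitePi_pi (fun _ : ℕ => ν) fun i _ => ht (m + i), Finset.prod_image]
  · rw [← Finset.prod_filter_mul_prod_filter_not s (· < m)]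
    congr 1
    refine Finset.prod_congr rfl fun k hk => ?_
    rw [Nat.add_sub_cancel' (not_lt.1 (Finset.mem_filter.1 hk).2)]
  · intro i hi j hj hij
    have h1 := (Finset.mem_filter.1 hi).2
    have h2 := (Finset.mem_filter.1 hj).2
    dsimp only at hij
    omega

lemma integral_glue (m : ℕ) {F : (ℕ → ι) → ℂ} (hF : Measurable F) {C : ℝ}
    (hC : ∀ ω, ‖F ω‖ ≤ C) :
    ∫ ω, F ω ∂(Measure.infinitePi fun _ : ℕ => ν)
      = ∫ ω₀, ∫ ω, F (glue m ω₀ ω) ∂(Measure.infinitePi fun _ : ℕ => ν)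
        ∂(Measure.infinitePi fun _ : ℕ => ν) := by
  conv_lhs => rw [← map_glue ν m]
  rw [integral_map (measurable_glue m).aemeasurable hF.aestronglyMeasurable, integral_prod]
  exact Integrable.of_bound (hF.comp (measurable_glue m)).aestronglyMeasurable C
    (ae_of_all _ fun q => hC _)

lemma integral_mul_eq_zero_of_glue (m : ℕ) {F G : (ℕ → ι) → ℂ} (hF : Measurable F)
    (hG : Measurable G) {C D : ℝ} (hC : ∀ ω, ‖F ω‖ ≤ C) (hD : ∀ ω, ‖G ω‖ ≤ D)
    (hFm : ∀ ω₀ ω, F (glue m ω₀ ω) = F ω₀)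
    (hG0 : ∀ ω₀, ∫ ω, G (glue m ω₀ ω) ∂(Measure.infinitePi fun _ : ℕ => ν) = 0) :
    ∫ ω, F ω * G ω ∂(Measure.infinitePi fun _ : ℕ => ν) = 0 := by
  rw [integral_glue ν m (F := fun ω => F ω * G ω) (hF.mul hG) (C := C * D) fun ω => ?_]
  · simp_rw [hFm, integral_const_mul, hG0]
    simp
  · rw [norm_mul]
    exact mul_le_mul (hC ω) (hD ω) (norm_nonneg _) ((norm_nonneg _).trans (hC ω))

open ComplexConjugate in
/-- A law of large numbers for bounded functions `Z j` on the sequence space that have mean zero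
conditionally on the first `j + c` coordinates, and are exponentially well approximated by
functions of finitely many coordinates. -/
lemma ae_tendsto_average_of_glue {Z : ℕ → (ℕ → ι) → ℂ} (c : ℕ) (hZ : ∀ j, Measurable (Z j))
    {C D r : ℝ} (hC : ∀ j ω, ‖Z j ω‖ ≤ C) (hr0 : 0 ≤ r) (hr1 : r < 1)
    (hZ0 : ∀ j ω₀, ∫ ω, Z j (glue (j + c) ω₀ ω) ∂(Measure.infinitePi fun _ : ℕ => ν) = 0)
    (hZr : ∀ j k ω ω', ‖Z j ω - Z j (glue (j + k + c) ω ω')‖ ≤ D * r ^ k) :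
    ∀ᵐ ω ∂(Measure.infinitePi fun _ : ℕ => ν),
      Tendsto (fun N : ℕ => (N : ℂ)⁻¹ * ∑ k ∈ Finset.range N, Z k ω) atTop (𝓝 0) := by
  set P := Measure.infinitePi fun _ : ℕ => ν with hP
  have hne : Nonempty (ℕ → ι) := by
    by_contra h
    have h0 : (Set.univ : Set (ℕ → ι)) = ∅ := by
      rw [not_nonempty_iff] at h
      exact Set.univ_eq_empty_iff.2 h
    have : P Set.univ = 1 := measure_univ
    simp [h0] at this
  obtain ⟨ω'⟩ := hne
  have hconj : Measurable (conj : ℂ → ℂ) := Complex.continuous_conj.measurable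
  refine ae_tendsto_average_of_correlation hZ hC
    ((summable_geometric_of_lt_one hr0 hr1).mul_left (D * C)) fun n k => ?_
  have hW : Measurable fun ω => Z n (glue (n + k + c) ω ω') :=
    (hZ n).comp ((measurable_glue _).comp (measurable_id.prodMk measurable_const))
  have hG : Measurable fun ω => conj (Z (n + k) ω) := hconj.comp (hZ _)
  have hGC : ∀ ω, ‖conj (Z (n + k) ω)‖ ≤ C := fun ω => by
    rw [RCLike.norm_conj]
    exact hC _ _
  have h0 : ∫ ω, Z n (glue (n + k + c) ω ω') * conj (Z (n + k) ω) ∂P = 0 := by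
    refine integral_mul_eq_zero_of_glue ν (n + k + c) hW hG (fun ω => hC _ _) hGC
      (fun ω₀ ω => ?_) fun ω₀ => ?_
    · congr 1
      ext i
      by_cases hi : i < n + k + c <;> simp [glue, hi]
    · rw [integral_conj, hZ0, map_zero]
  have hbd : ∀ F : (ℕ → ι) → ℂ, Measurable F → (∀ ω, ‖F ω‖ ≤ C) →
      Integrable (fun ω => F ω * conj (Z (n + k) ω)) P := fun F hF hFC => by
    refine Integrable.of_bound (C := C * C) (hF.mul hG).aestronglyMeasurable
      (ae_of_all _ fun ω => ?_)
    rw [norm_mul]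
    exact mul_le_mul (hFC ω) (hGC ω) (norm_nonneg _) ((norm_nonneg _).trans (hFC ω))
  have h1 : ∫ ω, Z n ω * conj (Z (n + k) ω) ∂P
      = ∫ ω, (Z n ω - Z n (glue (n + k + c) ω ω')) * conj (Z (n + k) ω) ∂P := by
    simp_rw [sub_mul]
    rw [integral_sub (hbd _ (hZ n) (hC n)) (hbd _ hW fun ω => hC _ _), h0, sub_zero]
  rw [h1]
  refine (norm_integral_le_of_norm_le_const (C := D * C * r ^ k)
    (ae_of_all _ fun ω => ?_)).trans (by simp)
  rw [norm_mul]
  calc _ ≤ D * r ^ k * C := mul_le_mul (hZr _ _ _ _) (hGC ω) (norm_nonneg _)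
        ((norm_nonneg _).trans (hZr n k ω ω'))
    _ = D * C * r ^ k := by ring

end Glue

/-- The contraction ratio of `f_{ω 0} ∘ ⋯ ∘ f_{ω (m - 1)}`. -/
def scale {ι : Type*} (s : ι → ℝ) (ω : ℕ → ι) (m : ℕ) : ℝ := ∏ k ∈ Finset.range m, s (ω k)

/-- The image of `0` under `f_{ω 0} ∘ ⋯ ∘ f_{ω (m - 1)}`. -/
def offset {ι : Type*} (s t : ι → ℝ) (ω : ℕ → ι) (m : ℕ) : ℝ :=
  ∑ k ∈ Finset.range m, scale s ω k * t (ω k)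

/-- The coding map of the iterated function system `f_i(x) = s_i x + t_i`. -/
noncomputable def coding {ι : Type*} (s t : ι → ℝ) (ω : ℕ → ι) : ℝ :=
  ∑' k, scale s ω k * t (ω k)

section Coding

variable {ι : Type*} {s t : ι → ℝ} {r T : ℝ}

lemma abs_scale_le (hs : ∀ i, |s i| ≤ r) (ω : ℕ → ι) (m : ℕ) : |scale s ω m| ≤ r ^ m := by
  rw [scale, Finset.abs_prod]
  refine (Finset.prod_le_prod (fun _ _ => abs_nonneg _) fun k _ => hs (ω k)).trans ?_
  simp

lemma scale_glue_of_le {m k : ℕ} (h : k ≤ m) (ω₀ ω : ℕ → ι) :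
    scale s (glue m ω₀ ω) k = scale s ω₀ k :=
  Finset.prod_congr rfl fun i hi => by
    rw [glue_of_lt (lt_of_lt_of_le (Finset.mem_range.1 hi) h)]

lemma scale_glue_add (m k : ℕ) (ω₀ ω : ℕ → ι) :
    scale s (glue m ω₀ ω) (m + k) = scale s ω₀ m * scale s ω k := by
  rw [← scale_glue_of_le le_rfl ω₀ ω, scale, Finset.prod_range_add]
  simp [scale, glue_add]

lemma scale_succ (ω : ℕ → ι) (m : ℕ) : scale s ω (m + 1) = scale s ω m * s (ω m) :=
  Finset.prod_range_succ _ _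

lemma abs_scale_add_le (hs : ∀ i, |s i| ≤ r) (ω : ℕ → ι) (m k : ℕ) :
    |scale s ω (m + k)| ≤ |scale s ω m| * r ^ k := by
  conv_lhs => rw [← glue_shift m ω]
  rw [scale_glue_add, abs_mul]
  exact mul_le_mul_of_nonneg_left (abs_scale_le hs _ _) (abs_nonneg _)

lemma abs_scale_mul_le (hs : ∀ i, |s i| ≤ r) (hT : ∀ i, |t i| ≤ T)
    (ω : ℕ → ι) (k : ℕ) : |scale s ω k * t (ω k)| ≤ T * r ^ k := by
  rw [abs_mul, mul_comm]
  exact mul_le_mul (hT _) (abs_scale_le hs ω k) (abs_nonneg _) ((abs_nonneg _).trans (hT (ω k)))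

lemma summable_coding (hs : ∀ i, |s i| ≤ r) (hr0 : 0 ≤ r) (hr1 : r < 1) (hT : ∀ i, |t i| ≤ T)
    (ω : ℕ → ι) : Summable fun k => scale s ω k * t (ω k) :=
  Summable.of_norm_bounded ((summable_geometric_of_lt_one hr0 hr1).mul_left T)
    (abs_scale_mul_le hs hT ω)

lemma abs_coding_le (hs : ∀ i, |s i| ≤ r) (hr0 : 0 ≤ r) (hr1 : r < 1) (hT : ∀ i, |t i| ≤ T)
    (ω : ℕ → ι) : |coding s t ω| ≤ T / (1 - r) := by
  have h := tsum_of_norm_bounded (f := fun k => scale s ω k * t (ω k))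
    ((hasSum_geometric_of_lt_one hr0 hr1).mul_left T)
    (abs_scale_mul_le hs hT ω)
  simpa [coding, div_eq_mul_inv] using h

lemma coding_glue (hs : ∀ i, |s i| ≤ r) (hr0 : 0 ≤ r) (hr1 : r < 1) (hT : ∀ i, |t i| ≤ T)
    (m : ℕ) (ω₀ ω : ℕ → ι) :
    coding s t (glue m ω₀ ω) = offset s t ω₀ m + scale s ω₀ m * coding s t ω := by
  rw [coding, ← (summable_coding hs hr0 hr1 hT (glue m ω₀ ω)).sum_add_tsum_nat_add m, coding,
    ← tsum_mul_left, offset]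
  congr 1
  · refine Finset.sum_congr rfl fun k hk => ?_
    have hk' := Finset.mem_range.1 hk
    rw [scale_glue_of_le hk'.le, glue_of_lt hk']
  · refine tsum_congr fun k => ?_
    rw [add_comm k m, scale_glue_add, glue_add, mul_assoc]

lemma coding_eq_shift (hs : ∀ i, |s i| ≤ r) (hr0 : 0 ≤ r) (hr1 : r < 1) (hT : ∀ i, |t i| ≤ T)
    (m : ℕ) (ω : ℕ → ι) :
    coding s t ω = offset s t ω m + scale s ω m * coding s t (fun k => ω (m + k)) := by
  conv_lhs => rw [← glue_shift m ω]
  exact coding_glue hs hr0 hr1 hT m _ _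

variable [MeasurableSpace ι] [DiscreteMeasurableSpace ι]

lemma measurable_scale (m : ℕ) : Measurable fun ω : ℕ → ι => scale s ω m :=
  Finset.measurable_prod _ fun k _ => (Measurable.of_discrete (f := s)).comp (measurable_pi_apply k)

lemma measurable_offset (m : ℕ) : Measurable fun ω : ℕ → ι => offset s t ω m :=
  Finset.measurable_sum _ fun k _ => (measurable_scale k).mul
    ((Measurable.of_discrete (f := t)).comp (measurable_pi_apply k))

lemma measurable_coding (hs : ∀ i, |s i| ≤ r) (hr0 : 0 ≤ r) (hr1 : r < 1)
    (hT : ∀ i, |t i| ≤ T) : Measurable fun ω : ℕ → ι => coding s t ω :=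
  measurable_of_tendsto_metrizable (fun m => measurable_offset (s := s) (t := t) m)
    (tendsto_pi_nhds.2 fun ω => (summable_coding hs hr0 hr1 hT ω).hasSum.tendsto_sum_nat)

end Coding

/-- The probability measure on a finite set with weights `p`. -/
noncomputable def weightMeasure {ι : Type*} [Fintype ι] [MeasurableSpace ι] (p : ι → ℝ) :
    Measure ι := ∑ i, ENNReal.ofReal (p i) • Measure.dirac i

section Weight

variable {ι : Type*} [Fintype ι] [MeasurableSpace ι] {p : ι → ℝ}

lemma isProbabilityMeasure_weightMeasure (hp : ∀ i, 0 < p i) (hsum : ∑ i, p i = 1) :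
    IsProbabilityMeasure (weightMeasure p) := by
  constructor
  simp only [weightMeasure, Measure.coe_finsetSum, Finset.sum_apply, Measure.smul_apply,
    measure_univ, smul_eq_mul, mul_one]
  rw [← ENNReal.ofReal_sum_of_nonneg fun i _ => (hp i).le, hsum, ENNReal.ofReal_one]

variable [DiscreteMeasurableSpace ι]

lemma integral_weightMeasure (hp : ∀ i, 0 < p i) (h : ι → ℂ) :
    ∫ i, h i ∂(weightMeasure p) = ∑ i, (p i : ℂ) * h i := by
  rw [weightMeasure, integral_finsetSum_measure]
  · refine Finset.sum_congr rfl fun i _ => ?_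
    rw [integral_smul_measure, integral_dirac, ENNReal.toReal_ofReal (hp i).le]
    simp
  · intro i _
    exact (integrable_dirac (by simp)).smul_measure (by simp)

lemma integral_eval_zero (hp : ∀ i, 0 < p i) (hsum : ∑ i, p i = 1) (h : ι → ℂ) :
    ∫ ω, h (ω 0) ∂(Measure.infinitePi fun _ : ℕ => weightMeasure p) = ∑ i, (p i : ℂ) * h i := by
  have := isProbabilityMeasure_weightMeasure hp hsum
  rw [← integral_weightMeasure hp]
  have hmp := measurePreserving_eval_infinitePi (fun _ : ℕ => weightMeasure p) 0
  have hh : Measurable h := .of_discrete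
  have := integral_map (μ := Measure.infinitePi fun _ : ℕ => weightMeasure p)
    hmp.measurable.aemeasurable (f := h) hh.aestronglyMeasurable
  rw [hmp.map_eq] at this
  exact this.symm

/-- A self-similar probability measure is the image of the Bernoulli measure under the coding
map. -/
lemma map_coding_eq {s t : ι → ℝ} {r T : ℝ} (hp : ∀ i, 0 < p i) (hsum : ∑ i, p i = 1)
    (hs : ∀ i, |s i| ≤ r) (hr0 : 0 ≤ r) (hr1 : r < 1) (hT : ∀ i, |t i| ≤ T)
    {μ : Measure ℝ} [IsProbabilityMeasure μ]
    (hself : μ = ∑ i, ENNReal.ofReal (p i) • Measure.map (fun x => s i * x + t i) μ) :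
    Measure.map (coding s t) (Measure.infinitePi fun _ : ℕ => weightMeasure p) = μ := by
  have := isProbabilityMeasure_weightMeasure hp hsum
  set P := Measure.infinitePi fun _ : ℕ => weightMeasure p with hP
  have hcm := measurable_coding hs hr0 hr1 hT
  set η := Measure.map (coding s t) P with hη
  have : IsProbabilityMeasure η := Measure.isProbabilityMeasure_map hcm.aemeasurable
  have hexp : ∀ u : ℝ, Continuous fun x : ℝ => Complex.exp (u * x * Complex.I) := fun u => by
    fun_prop
  have hnorm : ∀ u x : ℝ, ‖Complex.exp (u * x * Complex.I)‖ = 1 := fun u x => by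
    rw [← Complex.ofReal_mul, Complex.norm_exp_ofReal_mul_I]
  have hsplit : ∀ (i : ι) (u x : ℝ), Complex.exp (u * ((s i * x + t i : ℝ) : ℂ) * Complex.I)
      = Complex.exp (u * t i * Complex.I)
        * Complex.exp (((s i * u : ℝ) : ℂ) * x * Complex.I) := fun i u x => by
    rw [← Complex.exp_add]
    congr 1
    push_cast
    ring
  have hμ : ∀ u, charFun μ u
      = ∑ i, (p i : ℂ) * (Complex.exp (u * t i * Complex.I) * charFun μ (s i * u)) := by
    intro u
    conv_lhs => rw [hself, charFun_apply_real]
    rw [integral_finsetSum_measure]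
    · refine Finset.sum_congr rfl fun i _ => ?_
      rw [integral_smul_measure, ENNReal.toReal_ofReal (hp i).le,
        integral_map (by fun_prop) (hexp u).aestronglyMeasurable]
      simp_rw [hsplit]
      rw [integral_const_mul, charFun_apply_real]
      simp
    · intro i _
      have hm : Measurable fun x : ℝ => s i * x + t i := by fun_prop
      have := Measure.isProbabilityMeasure_map (μ := μ) hm.aemeasurable
      refine Integrable.smul_measure ?_ (by simp)
      exact Integrable.of_bound (hexp u).aestronglyMeasurable 1
        (ae_of_all _ fun x => (hnorm u x).le)
  have hη' : ∀ u, charFun η u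
      = ∑ i, (p i : ℂ) * (Complex.exp (u * t i * Complex.I) * charFun η (s i * u)) := by
    intro u
    have hc : ∀ u, charFun η u = ∫ ω, Complex.exp (u * coding s t ω * Complex.I) ∂P := fun u => by
      rw [charFun_apply_real, hη, integral_map hcm.aemeasurable (hexp u).aestronglyMeasurable]
    rw [hc u, integral_glue (weightMeasure p) 1
      (F := fun ω => Complex.exp (u * coding s t ω * Complex.I)) ((hexp u).measurable.comp hcm)
      (fun ω => (hnorm u _).le)]
    simp_rw [coding_glue hs hr0 hr1 hT]
    have hoff : ∀ ω₀ : ℕ → ι, ∀ ω, Complex.exp (u * ((offset s t ω₀ 1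
        + scale s ω₀ 1 * coding s t ω : ℝ) : ℂ) * Complex.I)
        = Complex.exp (u * t (ω₀ 0) * Complex.I)
        * Complex.exp (((s (ω₀ 0) * u : ℝ) : ℂ) * coding s t ω * Complex.I) := by
      intro ω₀ ω
      rw [← hsplit]
      simp [offset, scale, add_comm]
    simp_rw [hoff, integral_const_mul, ← hP, ← hc]
    exact integral_eval_zero hp hsum
      (fun i => Complex.exp (u * t i * Complex.I) * charFun η (s i * u))
  have hdiff : ∀ u, ‖charFun η u - charFun μ u‖
      ≤ ∑ i, p i * ‖charFun η (s i * u) - charFun μ (s i * u)‖ := by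
    intro u
    rw [hη' u, hμ u, ← Finset.sum_sub_distrib]
    refine norm_sum_le_of_le _ fun i _ => le_of_eq ?_
    rw [← mul_sub, ← mul_sub, norm_mul, norm_mul, Complex.norm_real, Real.norm_of_nonneg (hp i).le]
    have := hnorm u (t i)
    rw [this, one_mul]
  have hcont : Continuous fun u => ‖charFun η u - charFun μ u‖ := by
    fun_prop
  refine Measure.ext_of_charFun (funext fun u => ?_)
  rw [← sub_eq_zero, ← norm_le_zero_iff]
  refine le_of_forall_pos_le_add fun ε hε => ?_
  rw [zero_add]
  obtain ⟨δ, hδ, hδε⟩ := Metric.continuousAt_iff.1 (hcont.continuousAt (x := 0)) ε hε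
  have hsmall : ∀ v, |v| < δ → ‖charFun η v - charFun μ v‖ ≤ ε := by
    intro v hv
    have := hδε (x := v) (by simpa using hv)
    simp only [charFun_zero, probReal_univ, sub_self, norm_zero, dist_zero_right, norm_norm] at this
    exact this.le
  have hstep : ∀ k : ℕ, ∀ v, r ^ k * |v| < δ → ‖charFun η v - charFun μ v‖ ≤ ε := by
    intro k
    induction k with
    | zero => simpa using hsmall
    | succ k ih =>
      intro v hv
      refine (hdiff v).trans ?_
      calc _ ≤ ∑ i, p i * ε := by
            refine Finset.sum_le_sum fun i _ => mul_le_mul_of_nonneg_left (ih _ ?_) (hp i).le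
            refine lt_of_le_of_lt ?_ hv
            rw [abs_mul, pow_succ, mul_assoc]
            have := hs i
            gcongr
        _ = ε := by rw [← Finset.sum_mul, hsum, one_mul]
  have hlim : Tendsto (fun k : ℕ => r ^ k * |u|) atTop (𝓝 0) := by
    simpa using (tendsto_pow_atTop_nhds_zero_of_lt_one hr0 hr1).mul_const |u|
  obtain ⟨k, hk⟩ := (hlim.eventually_lt_const hδ).exists
  exact hstep k u hk

end Weight

section Walk

variable {ι : Type*} [Fintype ι] {p : ι → ℝ}

lemma sum_mul_unitChar_ne_one (hp : ∀ i, 0 < p i) (hsum : ∑ i, p i = 1) {a : ι → ℝ} {i : ι}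
    (hirr : Irrational (a i)) {l : ℤ} (hl : l ≠ 0) :
    ∑ i, (p i : ℂ) * unitChar (l * a i) ≠ 1 := by
  intro h
  have hre := congrArg Complex.re h
  simp only [Complex.re_sum, Complex.re_ofReal_mul, Complex.one_re, unitChar,
    Complex.exp_ofReal_mul_I_re] at hre
  have h0 : ∑ i, p i * (1 - Real.cos (2 * Real.pi * (l * a i))) = 0 := by
    simp_rw [mul_sub, mul_one]
    rw [Finset.sum_sub_distrib, hsum, hre, sub_self]
  have hi := (Finset.sum_eq_zero_iff_of_nonneg fun j _ => mul_nonneg (hp j).le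
    (sub_nonneg.2 (Real.cos_le_one _))).1 h0 i (Finset.mem_univ i)
  have hcos : Real.cos (2 * Real.pi * (l * a i)) = 1 := by
    have := (mul_eq_zero.1 hi).resolve_left (hp i).ne'
    linarith
  obtain ⟨k, hk⟩ := (Real.cos_eq_one_iff _).1 hcos
  have hla : (l : ℝ) * a i = k := by
    have := Real.pi_pos
    have h2 : (2 * Real.pi) * (l * a i) = (2 * Real.pi) * k := by linarith
    exact mul_left_cancel₀ (by positivity) h2
  exact (hirr.intCast_mul hl).ne_int k hla

/-- The partial sums of independent identically distributed steps, one of whose values is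
irrational, equidistribute modulo one almost surely. -/
lemma ae_tendsto_average_unitChar_walk [MeasurableSpace ι] [DiscreteMeasurableSpace ι]
    (hp : ∀ i, 0 < p i) (hsum : ∑ i, p i = 1) {a : ι → ℝ} {i : ι} (hirr : Irrational (a i)) :
    ∀ᵐ ω ∂(Measure.infinitePi fun _ : ℕ => weightMeasure p), ∀ l : ℤ, l ≠ 0 →
      Tendsto (fun N : ℕ => (N : ℂ)⁻¹ * ∑ j ∈ Finset.range N,
        unitChar (l * ∑ k ∈ Finset.range (j + 1), a (ω k))) atTop (𝓝 0) := by
  have := isProbabilityMeasure_weightMeasure hp hsum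
  rw [ae_all_iff]
  intro l
  by_cases hl : l = 0
  · exact ae_of_all _ fun ω h => absurd hl h
  set φ : ℂ := ∑ i, (p i : ℂ) * unitChar (l * a i) with hφ
  have hφ1 : φ ≠ 1 := sum_mul_unitChar_ne_one hp hsum hirr hl
  have hφn : ‖φ‖ ≤ 1 := by
    rw [← hsum]
    refine norm_sum_le_of_le _ fun i _ => ?_
    rw [norm_mul, norm_unitChar, mul_one, Complex.norm_real, Real.norm_of_nonneg (hp i).le]
  set W : ℕ → (ℕ → ι) → ℂ := fun m ω => unitChar (l * ∑ k ∈ Finset.range m, a (ω k)) with hW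
  set Z : ℕ → (ℕ → ι) → ℂ := fun m ω => W m ω * (unitChar (l * a (ω m)) - φ) with hZ
  have hWs : ∀ m ω, W (m + 1) ω = W m ω * unitChar (l * a (ω m)) := fun m ω => by
    simp only [hW]
    rw [← unitChar_add, Finset.sum_range_succ, mul_add]
  have hWn : ∀ m ω, ‖W m ω‖ = 1 := fun m ω => norm_unitChar _
  have hZn : ∀ m ω, ‖Z m ω‖ ≤ 2 := fun m ω => by
    rw [hZ, norm_mul, hWn, one_mul]
    refine (norm_sub_le _ _).trans ?_
    rw [norm_unitChar]
    linarith
  have hWg : ∀ {m k : ℕ}, m ≤ k → ∀ ω₀ ω, W m (glue k ω₀ ω) = W m ω₀ := fun {m k} h ω₀ ω => by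
    simp only [hW]
    congr 2
    exact Finset.sum_congr rfl fun j hj => by
      rw [glue_of_lt ((Finset.mem_range.1 hj).trans_le h)]
  have hmeas : ∀ m, Measurable (Z m) := fun m => by
    have hm : ∀ k, Measurable fun ω : ℕ → ι => a (ω k) := fun k =>
      (Measurable.of_discrete (f := a)).comp (measurable_pi_apply k)
    refine Measurable.mul ?_ (Measurable.sub_const ?_ _)
    · exact continuous_unitChar.measurable.comp
        (measurable_const.mul (Finset.measurable_sum _ fun k _ => hm k))
    · exact continuous_unitChar.measurable.comp (measurable_const.mul (hm m))
  have key := ae_tendsto_average_of_glue (weightMeasure p) 0 hmeas hZn (D := 4) (r := 1 / 2)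
    (by norm_num) (by norm_num) (fun j ω₀ => by
      have h1 : ∀ ω, Z j (glue (j + 0) ω₀ ω) = W j ω₀ * (unitChar (l * a (ω 0)) - φ) := fun ω => by
        simp only [hZ]
        rw [hWg (by omega)]
        congr 4
        simpa using congrArg a (glue_add j 0 ω₀ ω)
      simp_rw [h1]
      rw [integral_const_mul, integral_eval_zero hp hsum (fun i => unitChar (l * a i) - φ)]
      simp_rw [mul_sub]
      rw [Finset.sum_sub_distrib, ← hφ, ← Finset.sum_mul, ← Complex.ofReal_sum, hsum]
      simp)
    (fun j k ω ω' => by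
      rcases Nat.eq_zero_or_pos k with rfl | hk
      · rw [pow_zero]
        refine (norm_sub_le _ _).trans ?_
        linarith [hZn j ω, hZn j (glue (j + 0 + 0) ω ω')]
      · simp only [hZ]
        rw [hWg (by omega), glue_of_lt (by omega), sub_self, norm_zero]
        positivity)
  filter_upwards [key] with ω hω _
  have hsumW : ∀ N : ℕ, ∑ j ∈ Finset.range N, W (j + 1) ω
      = (1 - φ)⁻¹ * (∑ j ∈ Finset.range N, Z j ω - φ * (W N ω - W 0 ω)) := fun N => by
    rw [eq_inv_mul_iff_mul_eq₀ (sub_ne_zero.2 hφ1.symm)]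
    have h1 : ∑ j ∈ Finset.range N, Z j ω
        = ∑ j ∈ Finset.range N, W (j + 1) ω - φ * ∑ j ∈ Finset.range N, W j ω := by
      rw [Finset.mul_sum, ← Finset.sum_sub_distrib]
      refine Finset.sum_congr rfl fun j _ => ?_
      rw [hWs]
      ring
    have h2 := Finset.sum_range_sub (fun j => W j ω) N
    rw [Finset.sum_sub_distrib] at h2
    rw [h1, ← h2]
    ring
  have h0 : Tendsto (fun N : ℕ => (N : ℂ)⁻¹ * (φ * (W N ω - W 0 ω))) atTop (𝓝 0) := by
    refine squeeze_zero_norm (a := fun N : ℕ => (N : ℝ)⁻¹ * 2) (fun N => ?_) ?_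
    · rw [norm_mul, norm_mul, norm_inv, Complex.norm_natCast]
      refine mul_le_mul_of_nonneg_left ?_ (by positivity)
      have h3 : ‖W N ω - W 0 ω‖ ≤ 2 := (norm_sub_le _ _).trans (by rw [hWn, hWn]; norm_num)
      nlinarith [norm_nonneg φ, norm_nonneg (W N ω - W 0 ω)]
    · simpa using tendsto_natCast_atTop_atTop.inv_tendsto_atTop.mul_const (2 : ℝ)
  have h1 := (hω.sub h0).const_mul (1 - φ)⁻¹
  rw [sub_zero, mul_zero] at h1
  refine h1.congr fun N => ?_
  change _ = (N : ℂ)⁻¹ * ∑ j ∈ Finset.range N, W (j + 1) ω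
  rw [hsumW]
  ring

end Walk

section Wiener

lemma norm_integral_exp_rpow_le {b : ℝ} (hb : 1 < b) {v : ℝ} (hv : v ≠ 0) :
    ‖∫ t in (0 : ℝ)..1, Complex.exp (((v * b ^ (-t) : ℝ) : ℂ) * Complex.I)‖
      ≤ (b + 1 + b * Real.log b) / (Real.log b * |v|) := by
  have hb0 : 0 < b := by linarith
  have hlog : 0 < Real.log b := Real.log_pos hb
  set e : ℝ → ℂ := fun t => Complex.exp (((v * b ^ (-t) : ℝ) : ℂ) * Complex.I) with he
  have hen : ∀ t, ‖e t‖ = 1 := fun t => Complex.norm_exp_ofReal_mul_I _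
  have hpos : ∀ t : ℝ, 0 < b ^ t := fun t => Real.rpow_pos_of_pos hb0 t
  have hd1 : ∀ t : ℝ, HasDerivAt (fun t : ℝ => b ^ t) (Real.log b * b ^ t) t := fun t => by
    simpa [mul_comm] using (hasDerivAt_id t).const_rpow hb0
  have hd2 : ∀ t : ℝ, HasDerivAt (fun t : ℝ => b ^ (-t)) (-(Real.log b * b ^ (-t))) t := fun t => by
    simpa [mul_comm] using (hasDerivAt_neg t).const_rpow hb0
  have hde : ∀ t, HasDerivAt e (e t * (((v * -(Real.log b * b ^ (-t)) : ℝ) : ℂ) * Complex.I)) t :=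
    fun t => (((hd2 t).const_mul v).ofReal_comp.mul_const Complex.I).cexp
  have hcont1 : Continuous fun t : ℝ => b ^ t :=
    continuous_iff_continuousAt.2 fun t => (hd1 t).continuousAt
  have hcont : Continuous e := continuous_iff_continuousAt.2 fun t => (hde t).continuousAt
  have hdF : ∀ t, HasDerivAt (fun t => e t * ((b ^ t : ℝ) : ℂ))
      (e t * ((b ^ t * Real.log b : ℝ) : ℂ) - (v * Real.log b : ℝ) * Complex.I * e t) t := by
    intro t
    refine ((hde t).mul (hd1 t).ofReal_comp).congr_deriv ?_
    have h1 : (((b ^ (-t) : ℝ) : ℂ)) * ((b ^ t : ℝ) : ℂ) = 1 := by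
      rw [← Complex.ofReal_mul, ← Real.rpow_add hb0]
      simp
    push_cast at h1 ⊢
    linear_combination (-(e t) * v * Real.log b * Complex.I) * h1
  have hA : IntervalIntegrable (fun t => e t * ((b ^ t * Real.log b : ℝ) : ℂ)) volume 0 1 := by
    apply Continuous.intervalIntegrable
    fun_prop
  have hB : IntervalIntegrable (fun t => (v * Real.log b : ℝ) * Complex.I * e t) volume 0 1 := by
    apply Continuous.intervalIntegrable
    fun_prop
  have hFTC := intervalIntegral.integral_eq_sub_of_hasDerivAt (a := 0) (b := 1)
    (fun t _ => hdF t) (hA.sub hB)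
  rw [intervalIntegral.integral_sub hA hB, intervalIntegral.integral_const_mul] at hFTC
  have hAn : ‖∫ t in (0 : ℝ)..1, e t * ((b ^ t * Real.log b : ℝ) : ℂ)‖ ≤ b * Real.log b := by
    refine (intervalIntegral.norm_integral_le_of_norm_le_const (C := b * Real.log b)
      fun t ht => ?_).trans (by simp)
    rw [Set.uIoc_of_le zero_le_one] at ht
    rw [norm_mul, hen, one_mul, Complex.norm_real, 
      Real.norm_of_nonneg (by have := hpos t; positivity)]
    have : b ^ t ≤ b ^ (1 : ℝ) := Real.rpow_le_rpow_of_exponent_le hb.le ht.2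
    rw [Real.rpow_one] at this
    gcongr
  have hkey : ((v * Real.log b : ℝ) : ℂ) * Complex.I * ∫ t in (0 : ℝ)..1, e t
      = (∫ t in (0 : ℝ)..1, e t * ((b ^ t * Real.log b : ℝ) : ℂ)) - e 1 * (b : ℂ) + e 0 := by
    simp only [Real.rpow_one, Real.rpow_zero] at hFTC
    push_cast at hFTC ⊢
    linear_combination -hFTC
  have hn := congrArg norm hkey
  rw [norm_mul, norm_mul, Complex.norm_I, mul_one, Complex.norm_real, Real.norm_eq_abs, abs_mul,
    abs_of_pos hlog] at hn
  rw [le_div_iff₀ (by positivity)]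
  have h3 : ‖(∫ t in (0 : ℝ)..1, e t * ((b ^ t * Real.log b : ℝ) : ℂ)) - e 1 * (b : ℂ) + e 0‖
      ≤ b * Real.log b + b + 1 := by
    refine (norm_add_le _ _).trans ?_
    rw [hen]
    have := norm_sub_le (∫ t in (0 : ℝ)..1, e t * ((b ^ t * Real.log b : ℝ) : ℂ)) (e 1 * (b : ℂ))
    rw [norm_mul, hen, Complex.norm_real, Real.norm_of_nonneg hb0.le] at this
    linarith
  linarith

variable {μ : Measure ℝ} [IsProbabilityMeasure μ]

lemma sq_norm_charFun_eq (u : ℝ) :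
    ((‖charFun μ u‖ ^ 2 : ℝ) : ℂ)
      = ∫ q : ℝ × ℝ, Complex.exp (((u * (q.1 - q.2) : ℝ) : ℂ) * Complex.I) ∂(μ.prod μ) := by
  have h1 : ∀ q : ℝ × ℝ, Complex.exp (((u * (q.1 - q.2) : ℝ) : ℂ) * Complex.I)
      = Complex.exp (u * q.1 * Complex.I) * Complex.exp (((-u : ℝ) : ℂ) * q.2 * Complex.I) := by
    intro q
    rw [← Complex.exp_add]
    congr 1
    push_cast
    ring
  simp_rw [h1]
  rw [integral_prod_mul (fun x : ℝ => Complex.exp (u * x * Complex.I))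
    (fun x : ℝ => Complex.exp (((-u : ℝ) : ℂ) * x * Complex.I)),
    ← charFun_apply_real, ← charFun_apply_real, charFun_neg, Complex.mul_conj,
    Complex.normSq_eq_norm_sq]

/-- The Fourier transform of a non-atomic measure tends to zero in logarithmic averages. -/
lemma tendsto_integral_norm_charFun (hna : ∀ x, μ {x} = 0) {b c : ℝ} (hb : 1 < b) (hc : c ≠ 0) :
    Tendsto (fun i : ℕ => ∫ t in (0 : ℝ)..1, ‖charFun μ (c * b ^ ((i : ℝ) - t))‖) atTop (𝓝 0) := by
  have hb0 : 0 < b := by linarith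
  have hlog : 0 < Real.log b := Real.log_pos hb
  have hcr : ∀ i : ℕ, Continuous fun t : ℝ => c * b ^ ((i : ℝ) - t) := fun i =>
    continuous_const.mul (continuous_const.rpow (by fun_prop) fun t => Or.inl hb0.ne')
  have hcc : ∀ i : ℕ, Continuous fun t : ℝ => ‖charFun μ (c * b ^ ((i : ℝ) - t))‖ := fun i =>
    (continuous_charFun.comp (hcr i)).norm
  have hdiag : ∀ᵐ q ∂(μ.prod μ), q.1 ≠ q.2 := by
    have hm : MeasurableSet {q : ℝ × ℝ | q.1 = q.2} :=
      measurableSet_eq_fun measurable_fst measurable_snd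
    rw [ae_iff]
    simp only [ne_eq, not_not]
    rw [Measure.prod_apply hm]
    have : ∀ x : ℝ, Prod.mk x ⁻¹' {q : ℝ × ℝ | q.1 = q.2} = {x} := fun x => by
      ext y
      simp [eq_comm]
    simp [this, hna]
  set E : ℕ → ℝ → ℝ × ℝ → ℂ := fun i t q =>
    Complex.exp (((c * b ^ ((i : ℝ) - t) * (q.1 - q.2) : ℝ) : ℂ) * Complex.I) with hE
  have hEn : ∀ i t q, ‖E i t q‖ = 1 := fun i t q => Complex.norm_exp_ofReal_mul_I _
  have hEc : ∀ i, Continuous (Function.uncurry (E i)) := fun i => by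
    have := (hcr i).comp (continuous_fst (X := ℝ) (Y := ℝ × ℝ))
    simp only [hE, Function.uncurry_def]
    refine Complex.continuous_exp.comp (Continuous.mul ?_ continuous_const)
    exact Complex.continuous_ofReal.comp (this.mul (by fun_prop))
  have hJ : ∀ i : ℕ, ((∫ t in (0 : ℝ)..1, ‖charFun μ (c * b ^ ((i : ℝ) - t))‖ ^ 2 : ℝ) : ℂ)
      = ∫ q, (∫ t in (0 : ℝ)..1, E i t q) ∂(μ.prod μ) := fun i => by
    rw [← intervalIntegral.integral_ofReal]
    simp_rw [sq_norm_charFun_eq]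
    rw [intervalIntegral.integral_of_le zero_le_one]
    simp_rw [intervalIntegral.integral_of_le zero_le_one]
    refine integral_integral_swap (f := E i) ?_
    exact Integrable.of_bound (hEc i).aestronglyMeasurable 1 (ae_of_all _ fun q => (hEn i _ _).le)
  have hlim : Tendsto (fun i : ℕ => ∫ q, (∫ t in (0 : ℝ)..1, E i t q) ∂(μ.prod μ)) atTop (𝓝 0) := by
    rw [show (0 : ℂ) = ∫ _, (0 : ℂ) ∂(μ.prod μ) by simp]
    refine tendsto_integral_of_dominated_convergence (fun _ => 1) (fun i => ?_)
      (integrable_const 1) (fun i => ae_of_all _ fun q => ?_) ?_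
    · simp_rw [intervalIntegral.integral_of_le zero_le_one]
      exact (StronglyMeasurable.integral_prod_right (f := fun q t => E i t q)
        ((hEc i).comp continuous_swap).stronglyMeasurable).aestronglyMeasurable
    · exact (intervalIntegral.norm_integral_le_of_norm_le_const (C := 1)
        fun t _ => (hEn i t q).le).trans (by simp)
    · filter_upwards [hdiag] with q hq
      have hne : c * (q.1 - q.2) ≠ 0 := mul_ne_zero hc (sub_ne_zero.2 hq)
      refine squeeze_zero_norm (a := fun i : ℕ => (b + 1 + b * Real.log b)
        / (Real.log b * |c * (q.1 - q.2)|) * (b⁻¹) ^ i) (fun i => ?_) ?_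
      · have hbi : 0 < b ^ i := pow_pos hb0 i
        have := norm_integral_exp_rpow_le hb (v := c * (q.1 - q.2) * b ^ i)
          (mul_ne_zero hne hbi.ne')
        rw [abs_mul, abs_of_pos hbi] at this
        convert this using 1
        · congr 2
          ext t
          simp only [hE]
          congr 3
          rw [sub_eq_add_neg, Real.rpow_add hb0, Real.rpow_natCast]
          ring
        · rw [inv_pow]
          field_simp
      · simpa using (tendsto_pow_atTop_nhds_zero_of_lt_one (inv_nonneg.2 hb0.le)
          (inv_lt_one_of_one_lt₀ hb)).const_mul ((b + 1 + b * Real.log b)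
          / (Real.log b * |c * (q.1 - q.2)|))
  have hlimJ : Tendsto (fun i : ℕ => ∫ t in (0 : ℝ)..1, ‖charFun μ (c * b ^ ((i : ℝ) - t))‖ ^ 2)
      atTop (𝓝 0) := by
    have h := hlim.norm
    rw [norm_zero] at h
    refine h.congr fun i => ?_
    rw [← hJ, Complex.norm_real, Real.norm_of_nonneg]
    exact intervalIntegral.integral_nonneg zero_le_one fun t _ => by positivity
  have hle : ∀ i : ℕ, ∫ t in (0 : ℝ)..1, ‖charFun μ (c * b ^ ((i : ℝ) - t))‖
      ≤ Real.sqrt (∫ t in (0 : ℝ)..1, ‖charFun μ (c * b ^ ((i : ℝ) - t))‖ ^ 2) := fun i => by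
    set f : ℝ → ℝ := fun t => ‖charFun μ (c * b ^ ((i : ℝ) - t))‖ with hf
    set I := ∫ t in (0 : ℝ)..1, f t with hI
    refine Real.le_sqrt_of_sq_le ?_
    have h0 : 0 ≤ ∫ t in (0 : ℝ)..1, (f t ^ 2 - 2 * I * f t + I ^ 2) :=
      intervalIntegral.integral_nonneg zero_le_one fun t _ => by nlinarith [sq_nonneg (f t - I)]
    rw [intervalIntegral.integral_add, intervalIntegral.integral_sub,
      intervalIntegral.integral_const_mul, ← hI] at h0
    · simp only [intervalIntegral.integral_const, sub_zero, one_smul] at h0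
      nlinarith
    all_goals
      apply Continuous.intervalIntegrable
      have := hcc i
      fun_prop
  refine squeeze_zero (fun i => ?_) hle (by simpa using hlimJ.sqrt)
  exact intervalIntegral.integral_nonneg zero_le_one fun t _ => norm_nonneg _

end Wiener

section Deterministic

/-- A bounded sequence whose partial sums are small along an index sequence of linear growth with
bounded gaps has averages tending to zero. -/
lemma tendsto_average_of_subsequence {x : ℕ → ℂ} (hx : ∀ k, ‖x k‖ ≤ 1) {c : ℝ} (hc : 0 < c)
    {L : ℕ} (h : ∀ ε > 0, ∃ κ : ℕ → ℕ, Monotone κ ∧ (∀ j, κ (j + 1) ≤ κ j + L) ∧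
      (∀ j : ℕ, c * j ≤ κ j) ∧
      ∀ᶠ N : ℕ in atTop, ‖∑ k ∈ Finset.Ico (κ 0) (κ N), x k‖ ≤ ε * N) :
    Tendsto (fun n : ℕ => (n : ℂ)⁻¹ * ∑ k ∈ Finset.range n, x k) atTop (𝓝 0) := by
  have hcard : ∀ s : Finset ℕ, ‖∑ k ∈ s, x k‖ ≤ s.card := fun s => by
    refine (norm_sum_le_of_le s fun k _ => hx k).trans (by simp)
  refine Metric.tendsto_atTop.2 fun ε hε => ?_
  obtain ⟨κ, hmono, hgap, hgrow, hev⟩ := h (ε / 2 * c) (by positivity)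
  obtain ⟨N₀, hN₀⟩ := eventually_atTop.1 hev
  have hbound : ∀ N, ‖∑ k ∈ Finset.Ico (κ 0) (κ N), x k‖ ≤ ε / 2 * c * N + κ N₀ := by
    intro N
    rcases le_total N₀ N with hN | hN
    · linarith [hN₀ N hN, Nat.cast_nonneg (α := ℝ) (κ N₀)]
    · refine (hcard _).trans ?_
      have h1 : ((Finset.Ico (κ 0) (κ N)).card : ℝ) ≤ κ N₀ := by
        rw [Nat.card_Ico]
        exact_mod_cast (Nat.sub_le _ _).trans (hmono hN)
      have : 0 ≤ ε / 2 * c * N := by positivity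
      linarith
  set C : ℝ := κ 0 + κ N₀ + L with hC
  obtain ⟨n₀, hn₀⟩ := exists_nat_gt (2 * C / ε)
  refine ⟨max n₀ (κ 0 + 1), fun n hn => ?_⟩
  have hnκ : κ 0 ≤ n := by
    have := le_of_max_le_right hn
    omega
  have hex : ∃ N, n < κ (N + 1) := by
    obtain ⟨N, hN⟩ := exists_nat_gt ((n : ℝ) / c)
    refine ⟨N, ?_⟩
    have h1 := hgrow (N + 1)
    rw [div_lt_iff₀ hc] at hN
    have : (n : ℝ) < κ (N + 1) := by
      push_cast at h1
      nlinarith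
    exact_mod_cast this
  classical
  set N := Nat.find hex with hNdef
  have hN1 : n < κ (N + 1) := Nat.find_spec hex
  have hN2 : κ N ≤ n := by
    rcases Nat.eq_zero_or_pos N with h0 | hpos
    · rwa [h0]
    · have := Nat.find_min hex (m := N - 1) (by omega)
      rw [Nat.sub_add_cancel hpos] at this
      omega
  have hsplit : ∑ k ∈ Finset.range n, x k = ∑ k ∈ Finset.range (κ 0), x k
      + ∑ k ∈ Finset.Ico (κ 0) (κ N), x k + ∑ k ∈ Finset.Ico (κ N) n, x k := by
    rw [Finset.sum_range_add_sum_Ico _ (hmono (Nat.zero_le N)), Finset.sum_range_add_sum_Ico _ hN2]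
  have hnpos : (0 : ℝ) < n := by
    have := le_of_max_le_right hn
    exact_mod_cast (by omega : 0 < n)
  rw [dist_zero_right, norm_mul, norm_inv, Complex.norm_natCast, inv_mul_lt_iff₀ hnpos, hsplit]
  have e1 := hcard (Finset.range (κ 0))
  have e3 := hcard (Finset.Ico (κ N) n)
  have e3' : ((Finset.Ico (κ N) n).card : ℝ) ≤ L := by
    rw [Nat.card_Ico]
    have := hgap N
    exact_mod_cast (by omega : n - κ N ≤ L)
  rw [Finset.card_range] at e1
  have e4 : c * N ≤ n := (hgrow N).trans (by exact_mod_cast hN2)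
  have e5 : 2 * C < n * ε := by
    rw [div_lt_iff₀ hε] at hn₀
    have : (n₀ : ℝ) ≤ n := by exact_mod_cast le_of_max_le_left hn
    nlinarith
  calc _ ≤ ‖∑ k ∈ Finset.range (κ 0), x k‖ + ‖∑ k ∈ Finset.Ico (κ 0) (κ N), x k‖
        + ‖∑ k ∈ Finset.Ico (κ N) n, x k‖ := norm_add₃_le
    _ ≤ C + ε / 2 * (c * N) := by
        have := hbound N
        linarith
    _ < n * ε := by nlinarith

end Deterministic

section Block

variable {ι : Type*}

/-- The contraction ratio `|s i|` is `b ^ (-logRatio b s i)`. -/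
noncomputable def logRatio (b : ℝ) (s : ι → ℝ) (i : ι) : ℝ := -Real.log |s i| / Real.log b

/-- The exponent `θ` for which `|scale s ω m| = b ^ (-θ)`. -/
noncomputable def height (b : ℝ) (s : ι → ℝ) (ω : ℕ → ι) (m : ℕ) : ℝ :=
  ∑ k ∈ Finset.range m, logRatio b s (ω k)

/-- The first index `k` at which `b ^ k * |scale s ω j|` is at least `b ^ q`. -/
noncomputable def blockIndex (b : ℝ) (s : ι → ℝ) (q : ℝ) (ω : ℕ → ι) (j : ℕ) : ℕ :=
  ⌈height b s ω j + q⌉₊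

variable {b : ℝ} {s : ι → ℝ} {q : ℝ}

lemma logRatio_pos (hb : 1 < b) (hs0 : ∀ i, s i ≠ 0) (hs1 : ∀ i, |s i| < 1) (i : ι) :
    0 < logRatio b s i :=
  div_pos (neg_pos.2 (Real.log_neg (abs_pos.2 (hs0 i)) (hs1 i))) (Real.log_pos hb)

lemma rpow_neg_height (hb : 1 < b) (hs0 : ∀ i, s i ≠ 0) (ω : ℕ → ι) (m : ℕ) :
    b ^ (-height b s ω m) = |scale s ω m| := by
  have hb0 : 0 < b := by linarith
  induction m with
  | zero => simp [height, scale]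
  | succ m ih =>
    rw [height, Finset.sum_range_succ, neg_add, Real.rpow_add hb0, scale_succ, abs_mul, ← ih, height]
    congr 1
    rw [logRatio, Real.rpow_def_of_pos hb0, neg_div, neg_neg,
      mul_div_cancel₀ _ (Real.log_pos hb).ne', Real.exp_log (abs_pos.2 (hs0 _))]

lemma height_glue_of_le {m k : ℕ} (h : k ≤ m) (ω₀ ω : ℕ → ι) :
    height b s (glue m ω₀ ω) k = height b s ω₀ k :=
  Finset.sum_congr rfl fun i hi => by
    rw [glue_of_lt (lt_of_lt_of_le (Finset.mem_range.1 hi) h)]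

lemma blockIndex_glue_of_le {m k : ℕ} (h : k ≤ m) (ω₀ ω : ℕ → ι) :
    blockIndex b s q (glue m ω₀ ω) k = blockIndex b s q ω₀ k := by
  rw [blockIndex, height_glue_of_le h, blockIndex]

lemma height_succ (ω : ℕ → ι) (j : ℕ) :
    height b s ω (j + 1) = height b s ω j + logRatio b s (ω j) :=
  Finset.sum_range_succ _ _

lemma monotone_blockIndex (hpos : ∀ i, 0 < logRatio b s i) (ω : ℕ → ι) :
    Monotone (blockIndex b s q ω) :=
  monotone_nat_of_le_succ fun j => Nat.ceil_mono (by
    rw [height_succ]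
    linarith [hpos (ω j)])

lemma blockIndex_succ_le {D : ℕ} (hD : ∀ i, logRatio b s i ≤ D) (ω : ℕ → ι) (j : ℕ) :
    blockIndex b s q ω (j + 1) ≤ blockIndex b s q ω j + D := by
  refine Nat.ceil_le.2 ?_
  have := Nat.le_ceil (height b s ω j + q)
  rw [height_succ]
  push_cast [blockIndex]
  linarith [hD (ω j)]

lemma mul_le_blockIndex {c : ℝ} (hc : ∀ i, c ≤ logRatio b s i) (hq : 0 ≤ q) (ω : ℕ → ι) (j : ℕ) :
    c * j ≤ blockIndex b s q ω j := by
  have h1 : c * j ≤ height b s ω j := by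
    have := Finset.card_nsmul_le_sum (Finset.range j) (fun k => logRatio b s (ω k)) c
      fun k _ => hc (ω k)
    simpa [mul_comm, height] using this
  exact (by linarith : c * j ≤ height b s ω j + q).trans (Nat.le_ceil _)

lemma mem_Ico_blockIndex {ω : ℕ → ι} {j k : ℕ}
    (hk : k ∈ Finset.Ico (blockIndex b s q ω j) (blockIndex b s q ω (j + 1))) :
    height b s ω j + q ≤ k ∧ (k : ℝ) < height b s ω (j + 1) + q :=
  ⟨Nat.ceil_le.1 (Finset.mem_Ico.1 hk).1, Nat.lt_ceil.1 (Finset.mem_Ico.1 hk).2⟩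

lemma card_Ico_blockIndex_le {D : ℕ} (hD : ∀ i, logRatio b s i ≤ D) (ω : ℕ → ι) (j : ℕ) :
    ((Finset.Ico (blockIndex b s q ω j) (blockIndex b s q ω (j + 1))).card : ℝ) ≤ D := by
  rw [Nat.card_Ico]
  have := blockIndex_succ_le (q := q) hD ω j
  exact_mod_cast (by omega : _ ≤ D)

lemma norm_sum_block_le {D : ℕ} (hD : ∀ i, logRatio b s i ≤ D) (ω : ℕ → ι) (j : ℕ) {x : ℕ → ℂ}
    {C : ℝ} (hC0 : 0 ≤ C) (hC : ∀ k ∈ Finset.Ico (blockIndex b s q ω j)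
      (blockIndex b s q ω (j + 1)), ‖x k‖ ≤ C) :
    ‖∑ k ∈ Finset.Ico (blockIndex b s q ω j) (blockIndex b s q ω (j + 1)), x k‖ ≤ D * C := by
  refine (norm_sum_le_of_le _ hC).trans ?_
  rw [Finset.sum_const, nsmul_eq_mul]
  exact mul_le_mul_of_nonneg_right (card_Ico_blockIndex_le hD ω j) hC0

lemma pow_mul_scale (hb : 1 < b) (hs0 : ∀ i, s i ≠ 0) (ω : ℕ → ι) (j k : ℕ) :
    b ^ k * |scale s ω j| = b ^ ((k : ℝ) - height b s ω j) := by
  rw [← rpow_neg_height hb hs0, sub_eq_add_neg, Real.rpow_add (by linarith), Real.rpow_natCast]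

lemma pow_mul_scale_le (hb : 1 < b) (hs0 : ∀ i, s i ≠ 0) {ω : ℕ → ι} {j k : ℕ}
    (hk : k ∈ Finset.Ico (blockIndex b s q ω j) (blockIndex b s q ω (j + 1))) :
    b ^ k * |scale s ω (j + 1)| ≤ b ^ q := by
  rw [pow_mul_scale hb hs0]
  refine Real.rpow_le_rpow_of_exponent_le hb.le ?_
  linarith [(mem_Ico_blockIndex hk).2]

/-- The exponential sum over the `j`-th block of indices. -/
noncomputable def blockSum (b : ℝ) (s : ι → ℝ) (q : ℝ) (G : (ℕ → ι) → ℝ) (j : ℕ) (ω : ℕ → ι) : ℂ :=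
  ∑ k ∈ Finset.Ico (blockIndex b s q ω j) (blockIndex b s q ω (j + 1)), unitChar (b ^ k * G ω)

lemma norm_blockSum_le {D : ℕ} (hD : ∀ i, logRatio b s i ≤ D) (G : (ℕ → ι) → ℝ) (j : ℕ)
    (ω : ℕ → ι) : ‖blockSum b s q G j ω‖ ≤ D := by
  simpa [blockSum] using norm_sum_block_le hD ω j (x := fun k => unitChar (b ^ k * G ω)) zero_le_one
    fun k _ => (norm_unitChar _).le

lemma sum_blockSum (hpos : ∀ i, 0 < logRatio b s i) (G : (ℕ → ι) → ℝ) (ω : ℕ → ι) (N : ℕ) :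
    ∑ j ∈ Finset.range N, blockSum b s q G j ω
      = ∑ k ∈ Finset.Ico (blockIndex b s q ω 0) (blockIndex b s q ω N), unitChar (b ^ k * G ω) := by
  induction N with
  | zero => simp
  | succ N ih =>
    rw [Finset.sum_range_succ, ih, blockSum]
    exact Finset.sum_Ico_consecutive _ (monotone_blockIndex hpos ω (Nat.zero_le N))
      (monotone_blockIndex hpos ω N.le_succ)

lemma glue_glue_of_le {m k : ℕ} (h : m ≤ k) (ω₀ ω₁ ω : ℕ → ι) :
    glue m (glue k ω₀ ω₁) ω = glue m ω₀ ω := by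
  ext i
  by_cases hi : i < m
  · simp [glue, hi, hi.trans_le h]
  · simp [glue, hi]

variable [MeasurableSpace ι] [DiscreteMeasurableSpace ι]

lemma measurable_blockIndex (j : ℕ) : Measurable fun ω : ℕ → ι => blockIndex b s q ω j := by
  refine Nat.measurable_ceil.comp (Measurable.add_const ?_ q)
  exact Finset.measurable_sum _ fun k _ =>
    (Measurable.of_discrete (f := logRatio b s)).comp (measurable_pi_apply k)

lemma measurable_blockSum (hpos : ∀ i, 0 < logRatio b s i) {G : (ℕ → ι) → ℝ} (hG : Measurable G)
    (j : ℕ) : Measurable (blockSum b s q G j) := by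
  have hS : Measurable fun y : ℕ × ℝ => ∑ k ∈ Finset.range y.1, unitChar (b ^ k * y.2) :=
    measurable_from_prod_countable_right fun n =>
      Continuous.measurable <| continuous_finsetSum (Finset.range n)
        (f := fun k (y : ℝ) => unitChar (b ^ k * y)) fun k _ => by fun_prop
  have h : blockSum b s q G j = fun ω =>
      ∑ k ∈ Finset.range (blockIndex b s q ω (j + 1)), unitChar (b ^ k * G ω)
      - ∑ k ∈ Finset.range (blockIndex b s q ω j), unitChar (b ^ k * G ω) := by
    ext ω
    exact Finset.sum_Ico_eq_sub _ (monotone_blockIndex hpos ω j.le_succ)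
  rw [h]
  exact (hS.comp ((measurable_blockIndex (j + 1)).prodMk hG)).sub
    (hS.comp ((measurable_blockIndex j).prodMk hG))

end Block

section Approximation

variable {ι : Type*} {s t : ι → ℝ} {r T : ℝ}

lemma abs_coding_sub_glue_le (hs : ∀ i, |s i| ≤ r) (hr0 : 0 ≤ r) (hr1 : r < 1)
    (hT : ∀ i, |t i| ≤ T) (m k : ℕ) (ω ω' : ℕ → ι) :
    |coding s t ω - coding s t (glue (m + k) ω ω')|
      ≤ |scale s ω m| * r ^ k * (2 * (T / (1 - r))) := by
  rw [coding_glue hs hr0 hr1 hT, coding_eq_shift hs hr0 hr1 hT (m + k) ω, add_sub_add_left_eq_sub,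
    ← mul_sub, abs_mul]
  refine mul_le_mul (abs_scale_add_le hs ω m k) ?_ (abs_nonneg _) (by positivity)
  refine (abs_sub _ _).trans ?_
  have h1 := abs_coding_le hs hr0 hr1 hT (fun i => ω (m + k + i))
  have h2 := abs_coding_le hs hr0 hr1 hT ω'
  linarith

variable [Fintype ι] [MeasurableSpace ι] [DiscreteMeasurableSpace ι] {p : ι → ℝ} {b q : ℝ}

/-- Block sums are asymptotically equal on average to their conditional expectations. -/
lemma ae_tendsto_average_blockSum_sub (hp : ∀ i, 0 < p i) (hsum : ∑ i, p i = 1)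
    (hs : ∀ i, |s i| ≤ r) (hr0 : 0 ≤ r) (hr1 : r < 1) (hs0 : ∀ i, s i ≠ 0)
    (hT : ∀ i, |t i| ≤ T) (hb : 1 < b) {D : ℕ} (hD : ∀ i, logRatio b s i ≤ D)
    {g : ℝ → ℝ} (hg : ContDiff ℝ 1 g) :
    ∀ᵐ ω ∂(Measure.infinitePi fun _ : ℕ => weightMeasure p),
      Tendsto (fun N : ℕ => (N : ℂ)⁻¹ * ∑ j ∈ Finset.range N,
        (blockSum b s q (fun ω => g (coding s t ω)) j ω
          - ∫ ω', blockSum b s q (fun ω => g (coding s t ω)) j (glue (j + 1) ω ω')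
              ∂(Measure.infinitePi fun _ : ℕ => weightMeasure p))) atTop (𝓝 0) := by
  have := isProbabilityMeasure_weightMeasure hp hsum
  set P := Measure.infinitePi fun _ : ℕ => weightMeasure p with hP
  have hb0 : 0 < b := by linarith
  have hpos := logRatio_pos hb hs0 fun i => (hs i).trans_lt hr1
  set R := T / (1 - r) with hR
  set G : (ℕ → ι) → ℝ := fun ω => g (coding s t ω) with hG
  have hGm : Measurable G := hg.continuous.measurable.comp (measurable_coding hs hr0 hr1 hT)
  have hmem : ∀ ω, coding s t ω ∈ Set.Icc (-R) R := fun ω =>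
    abs_le.1 (abs_coding_le hs hr0 hr1 hT ω)
  obtain ⟨K, hK⟩ := (hg.locallyLipschitz.locallyLipschitzOn (s := Set.Icc (-R) R)
    ).exists_lipschitzOnWith_of_compact isCompact_Icc
  have hYm := fun j => measurable_blockSum (q := q) hpos hGm j
  have hYn := fun j ω => norm_blockSum_le (q := q) hD G j ω
  set Y := blockSum b s q G with hY
  set E : ℕ → (ℕ → ι) → ℂ := fun j ω => ∫ ω', Y j (glue (j + 1) ω ω') ∂P with hE
  have hEm : ∀ j, Measurable (E j) := fun j =>
    (StronglyMeasurable.integral_prod_right (f := fun ω ω' => Y j (glue (j + 1) ω ω'))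
      ((hYm j).comp (measurable_glue (j + 1))).stronglyMeasurable).measurable
  have hEn : ∀ j ω, ‖E j ω‖ ≤ D := fun j ω =>
    (norm_integral_le_of_norm_le_const (ae_of_all _ fun ω' => hYn j _)).trans (by simp)
  have hEg : ∀ j k, j + 1 ≤ k → ∀ ω ω', E j (glue k ω ω') = E j ω := fun j k h ω ω' => by
    simp only [hE, glue_glue_of_le h]
  refine ae_tendsto_average_of_glue (weightMeasure p) (Z := fun j ω => Y j ω - E j ω) 1
    (fun j => (hYm j).sub (hEm j)) (C := 2 * D)
    (D := D * (2 * Real.pi * (b ^ q * (K * (2 * R))))) (r := r) (fun j ω => ?_) hr0 hr1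
    (fun j ω₀ => ?_) fun j k ω ω' => ?_
  · linarith [norm_sub_le (Y j ω) (E j ω), hYn j ω, hEn j ω]
  · simp_rw [hEg j (j + 1) le_rfl]
    rw [integral_sub, integral_const, probReal_univ, one_smul, sub_self]
    · refine Integrable.of_bound (C := D) ?_ (ae_of_all _ fun ω => hYn j _)
      exact ((hYm j).comp ((measurable_glue _).comp
        (measurable_const.prodMk measurable_id))).aestronglyMeasurable
    · exact integrable_const _
  · rw [hEg j _ (by omega), sub_sub_sub_cancel_right]
    simp only [hY, blockSum]
    rw [blockIndex_glue_of_le (by omega), blockIndex_glue_of_le (by omega),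
      ← Finset.sum_sub_distrib, mul_assoc]
    have hR0 : 0 ≤ R := (abs_nonneg _).trans (abs_coding_le hs hr0 hr1 hT ω)
    refine norm_sum_block_le hD ω j (by positivity) fun l hl => ?_
    refine (norm_unitChar_sub_le _ _).trans ?_
    rw [mul_assoc (2 * Real.pi)]
    refine mul_le_mul_of_nonneg_left ?_ (by positivity)
    rw [← mul_sub, abs_mul, abs_of_pos (pow_pos hb0 l)]
    have h1 := hK.dist_le_mul _ (hmem ω) _ (hmem (glue (j + k + 1) ω ω'))
    rw [Real.dist_eq, Real.dist_eq] at h1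
    have h2 := abs_coding_sub_glue_le hs hr0 hr1 hT (j + 1) k ω ω'
    rw [add_right_comm] at h2
    have h3 := pow_mul_scale_le hb hs0 hl
    calc b ^ l * |G ω - G (glue (j + k + 1) ω ω')|
        ≤ b ^ l * (K * (|scale s ω (j + 1)| * r ^ k * (2 * R))) := by
          refine mul_le_mul_of_nonneg_left (h1.trans ?_) (by positivity)
          exact mul_le_mul_of_nonneg_left h2 K.2
      _ = (b ^ l * |scale s ω (j + 1)|) * (K * (2 * R) * r ^ k) := by ring
      _ ≤ b ^ q * (K * (2 * R) * r ^ k) := mul_le_mul_of_nonneg_right h3 (by positivity)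
      _ = b ^ q * (K * (2 * R)) * r ^ k := by ring

lemma norm_charFun_abs (μ : Measure ℝ) (u v : ℝ) : ‖charFun μ (u * |v|)‖ = ‖charFun μ (u * v)‖ := by
  rcases abs_choice v with h | h
  · rw [h]
  · rw [h, mul_neg, charFun_neg, RCLike.norm_conj]

lemma norm_integral_unitChar (μ : Measure ℝ) (u v : ℝ) :
    ‖∫ x, unitChar (u + v * x) ∂μ‖ = ‖charFun μ (2 * Real.pi * v)‖ := by
  simp_rw [unitChar_add]
  rw [integral_const_mul, norm_mul, norm_unitChar, one_mul, charFun_apply_real]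
  congr 2
  ext x
  rw [unitChar]
  congr 1
  push_cast
  ring

/-- The conditional expectation of a block sum is controlled by the Fourier transform of the
self-similar measure, through the linearization of `g`. -/
lemma norm_integral_blockSum_le (hp : ∀ i, 0 < p i) (hsum : ∑ i, p i = 1)
    (hs : ∀ i, |s i| ≤ r) (hr0 : 0 ≤ r) (hr1 : r < 1) (hs0 : ∀ i, s i ≠ 0)
    (hT : ∀ i, |t i| ≤ T) (hb : 1 < b) {D : ℕ} (hD : ∀ i, logRatio b s i ≤ D)
    {μ : Measure ℝ} (hμ : Measure.map (coding s t)
      (Measure.infinitePi fun _ : ℕ => weightMeasure p) = μ)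
    {g : ℝ → ℝ} (hg : ContDiff ℝ 1 g) {C : ℕ → ℝ} (hC0 : ∀ j, 0 ≤ C j) (ω : ℕ → ι) {η : ℝ} (hη : 0 < η)
    (hC : ∀ j, ∀ k ∈ Finset.Ico (blockIndex b s q ω j) (blockIndex b s q ω (j + 1)),
      ‖charFun μ (2 * Real.pi * deriv g (coding s t ω) * (b ^ k * |scale s ω (j + 1)|))‖ ≤ C j) :
    ∀ᶠ j in atTop, ‖∫ ω', blockSum b s q (fun ω => g (coding s t ω)) j (glue (j + 1) ω ω')
      ∂(Measure.infinitePi fun _ : ℕ => weightMeasure p)‖ ≤ D * (C j + η) := by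
  have := isProbabilityMeasure_weightMeasure hp hsum
  set P := Measure.infinitePi fun _ : ℕ => weightMeasure p with hP
  have hb0 : 0 < b := by linarith
  set x := coding s t ω with hx
  set γ := deriv g x with hγ
  set R := T / (1 - r) with hR
  have hR0 : 0 ≤ R := (abs_nonneg _).trans (abs_coding_le hs hr0 hr1 hT ω)
  have hcm := measurable_coding hs hr0 hr1 hT
  have hgm : ∀ m, Measurable fun ω' => coding s t (glue m ω ω') := fun m =>
    hcm.comp ((measurable_glue m).comp (measurable_const.prodMk measurable_id))
  have hbq : 0 < b ^ q := Real.rpow_pos_of_pos hb0 q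
  set B := 2 * Real.pi * (b ^ q * (2 * R)) with hB
  have hB0 : 0 ≤ B := by positivity
  have hd : HasDerivAt g γ x := (hg.differentiable one_ne_zero x).hasDerivAt
  obtain ⟨δ, hδ, hδη⟩ := Metric.eventually_nhds_iff.1
    ((hasDerivAt_iff_isLittleO.1 hd).def (show 0 < η / (B + 1) by positivity))
  have hlim : Tendsto (fun j : ℕ => r ^ (j + 1) * (2 * R)) atTop (𝓝 0) := by
    simpa using ((tendsto_pow_atTop_nhds_zero_of_lt_one hr0 hr1).comp
      (tendsto_add_atTop_nat 1)).mul_const (2 * R)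
  filter_upwards [hlim.eventually_lt_const hδ] with j hj
  set σ := scale s ω (j + 1) with hσ
  have hdist : ∀ ω', |coding s t (glue (j + 1) ω ω') - x| ≤ |σ| * (2 * R) := fun ω' => by
    have := abs_coding_sub_glue_le hs hr0 hr1 hT (j + 1) 0 ω ω'
    rw [abs_sub_comm]
    simpa using this
  have happrox : ∀ ω', |g (coding s t (glue (j + 1) ω ω')) - g x
      - (coding s t (glue (j + 1) ω ω') - x) * γ| ≤ η / (B + 1) * (|σ| * (2 * R)) := fun ω' => by
    refine (hδη (y := coding s t (glue (j + 1) ω ω')) ?_).trans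
      (mul_le_mul_of_nonneg_left (hdist ω') (by positivity))
    rw [Real.dist_eq]
    refine (hdist ω').trans_lt (lt_of_le_of_lt ?_ hj)
    exact mul_le_mul_of_nonneg_right (abs_scale_le hs ω (j + 1)) (by positivity)
  have hint : ∀ F : (ℕ → ι) → ℝ, Measurable F → Integrable (fun ω' => unitChar (F ω')) P :=
    fun F hF => Integrable.of_bound (C := 1)
      (continuous_unitChar.measurable.comp hF).aestronglyMeasurable
      (ae_of_all _ fun ω' => (norm_unitChar _).le)
  have hF : ∀ k : ℕ, Measurable fun ω' => b ^ k * g (coding s t (glue (j + 1) ω ω')) := fun k =>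
    (hg.continuous.measurable.comp (hgm _)).const_mul _
  simp only [blockSum]
  simp_rw [blockIndex_glue_of_le (Nat.le_succ j), blockIndex_glue_of_le (le_refl (j + 1))]
  rw [integral_finsetSum _ fun k _ => hint _ (hF k)]
  refine norm_sum_block_le hD ω j (add_nonneg (hC0 j) hη.le) fun k hk => ?_
  set u := b ^ k * (g x + γ * (offset s t ω (j + 1) - x)) with hu
  set v := b ^ k * (γ * σ) with hv
  have hL : Measurable fun ω' => u + v * coding s t ω' := (hcm.const_mul v).const_add u
  have h1 : ‖∫ ω', unitChar (u + v * coding s t ω') ∂P‖ ≤ C j := by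
    refine le_trans (le_of_eq ?_) (hC j k hk)
    have h2 : ∫ ω', unitChar (u + v * coding s t ω') ∂P = ∫ z, unitChar (u + v * z) ∂μ := by
      rw [← hμ, integral_map hcm.aemeasurable]
      exact (by fun_prop : Continuous fun z => unitChar (u + v * z)).aestronglyMeasurable
    have h3 : 2 * Real.pi * γ * (b ^ k * |σ|) = 2 * Real.pi * γ * b ^ k * |σ| := by ring
    rw [h2, norm_integral_unitChar, h3, norm_charFun_abs]
    congr 2
    rw [hv]
    ring
  have h2 : ‖∫ ω', (unitChar (b ^ k * g (coding s t (glue (j + 1) ω ω')))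
      - unitChar (u + v * coding s t ω')) ∂P‖ ≤ η := by
    refine (norm_integral_le_of_norm_le_const (C := η) (ae_of_all _ fun ω' => ?_)).trans (by simp)
    refine (norm_unitChar_sub_le _ _).trans ?_
    have h3 : b ^ k * g (coding s t (glue (j + 1) ω ω')) - (u + v * coding s t ω')
        = b ^ k * (g (coding s t (glue (j + 1) ω ω')) - g x
          - (coding s t (glue (j + 1) ω ω') - x) * γ) := by
      rw [hu, hv, coding_glue hs hr0 hr1 hT]
      ring
    rw [h3, abs_mul, abs_of_pos (pow_pos hb0 k)]
    have h4 := pow_mul_scale_le hb hs0 hk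
    calc 2 * Real.pi * (b ^ k * _)
        ≤ 2 * Real.pi * (b ^ k * (η / (B + 1) * (|σ| * (2 * R)))) := by
          gcongr
          exact happrox ω'
      _ = (b ^ k * |σ|) * (2 * Real.pi * (η / (B + 1) * (2 * R))) := by ring
      _ ≤ b ^ q * (2 * Real.pi * (η / (B + 1) * (2 * R))) :=
          mul_le_mul_of_nonneg_right h4 (by positivity)
      _ = B * (η / (B + 1)) := by rw [hB]; ring
      _ ≤ (B + 1) * (η / (B + 1)) := by gcongr; linarith
      _ = η := by field_simp
  rw [integral_sub (hint _ (hF k)) (hint _ hL)] at h2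
  have h3 := norm_add_le (∫ ω', unitChar (b ^ k * g (coding s t (glue (j + 1) ω ω'))) ∂P
    - ∫ ω', unitChar (u + v * coding s t ω') ∂P) (∫ ω', unitChar (u + v * coding s t ω') ∂P)
  rw [sub_add_cancel] at h3
  linarith

end Approximation

section Normality

variable {ι : Type*} [Fintype ι] [MeasurableSpace ι] [DiscreteMeasurableSpace ι]
  {s t p : ι → ℝ} {r T b : ℝ}

/-- Along almost every coding, the exponential sums of a diffeomorphic image of a non-atomic
self-similar measure have averages tending to zero. -/
lemma ae_tendsto_average_unitChar_coding (hp : ∀ i, 0 < p i) (hsum : ∑ i, p i = 1)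
    (hs : ∀ i, |s i| ≤ r) (hr0 : 0 ≤ r) (hr1 : r < 1) (hs0 : ∀ i, s i ≠ 0)
    (hT : ∀ i, |t i| ≤ T) (hb : 1 < b) {i₀ : ι} (hirr : Irrational (logRatio b s i₀))
    {μ : Measure ℝ} [IsProbabilityMeasure μ] (hna : ∀ x, μ {x} = 0)
    (hμ : Measure.map (coding s t) (Measure.infinitePi fun _ : ℕ => weightMeasure p) = μ)
    {g : ℝ → ℝ} (hg : ContDiff ℝ 1 g) (hg' : ∀ x, deriv g x ≠ 0) :
    ∀ᵐ ω ∂(Measure.infinitePi fun _ : ℕ => weightMeasure p),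
      Tendsto (fun n : ℕ => (n : ℂ)⁻¹ * ∑ k ∈ Finset.range n, unitChar (b ^ k * g (coding s t ω)))
        atTop (𝓝 0) := by
  have hb0 : 0 < b := by linarith
  have hpos := logRatio_pos hb hs0 fun i => (hs i).trans_lt hr1
  have : Nonempty ι := ⟨i₀⟩
  obtain ⟨i₁, hi₁⟩ := Finite.exists_min (logRatio b s)
  obtain ⟨i₂, hi₂⟩ := Finite.exists_max (logRatio b s)
  obtain ⟨D, hD₂⟩ := exists_nat_ge (logRatio b s i₂)
  have hD : ∀ i, logRatio b s i ≤ D := fun i => (hi₂ i).trans hD₂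
  have hblocks := ae_all_iff.2 fun Q : ℕ =>
    ae_tendsto_average_blockSum_sub (q := Q + D) hp hsum hs hr0 hr1 hs0 hT hb hD hg
  filter_upwards [ae_tendsto_average_unitChar_walk hp hsum hirr, hblocks] with ω hwalk hblock
  set c := 2 * Real.pi * deriv g (coding s t ω) with hc
  have hc0 : c ≠ 0 := mul_ne_zero (by positivity) (hg' _)
  set Φ : ℝ → ℝ → ℝ := fun w y => ‖charFun μ (c * b ^ (w - y))‖ with hΦ
  have hΦc : ∀ w, Continuous (Φ w) := fun w =>
    (continuous_charFun.comp (continuous_const.mul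
      (continuous_const.rpow (by fun_prop) fun t => Or.inl hb0.ne'))).norm
  set H : ℕ → ℝ → ℝ := fun Q y => ∑ i ∈ Finset.range (D + 1), Φ ((Q + i : ℕ) : ℝ) y with hH
  have hHc : ∀ Q, Continuous (H Q) := fun Q =>
    continuous_finsetSum _ fun i _ => hΦc _
  have hHlim : Tendsto (fun Q : ℕ => D * ∫ y in (0 : ℝ)..1, H Q y) atTop (𝓝 0) := by
    have h1 : Tendsto (fun Q : ℕ => ∑ i ∈ Finset.range (D + 1),
        ∫ y in (0 : ℝ)..1, Φ ((Q + i : ℕ) : ℝ) y) atTop (𝓝 (∑ i ∈ Finset.range (D + 1), 0)) :=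
      tendsto_finsetSum _ fun i _ => (tendsto_integral_norm_charFun hna hb hc0).comp
        (tendsto_add_atTop_nat i)
    rw [Finset.sum_const_zero] at h1
    have h2 := h1.const_mul (D : ℝ)
    rw [mul_zero] at h2
    refine h2.congr fun Q => ?_
    rw [intervalIntegral.integral_finsetSum fun i _ => (hΦc _).intervalIntegrable _ _]
  refine tendsto_average_of_subsequence (fun k => (norm_unitChar _).le) (hpos i₁) (L := D)
    fun ε hε => ?_
  obtain ⟨Q, hQ⟩ := (hHlim.eventually_lt_const (show 0 < ε / 4 by positivity)).exists
  refine ⟨blockIndex b s (Q + D) ω, monotone_blockIndex hpos ω, blockIndex_succ_le hD ω,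
    mul_le_blockIndex hi₁ (by positivity) ω, ?_⟩
  set θ : ℕ → ℝ := fun j => height b s ω (j + 1) with hθ
  have hHavg : Tendsto (fun N : ℕ => (N : ℝ)⁻¹ * ∑ j ∈ Finset.range N, H Q (Int.fract (θ j)))
      atTop (𝓝 (∫ y in (0 : ℝ)..1, H Q y)) := tendsto_average_fract hwalk (hHc Q)
  have hC : ∀ j, ∀ k ∈ Finset.Ico (blockIndex b s (Q + D) ω j) (blockIndex b s (Q + D) ω (j + 1)),
      ‖charFun μ (c * (b ^ k * |scale s ω (j + 1)|))‖ ≤ H Q (Int.fract (θ j)) := by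
    intro j k hk
    obtain ⟨h1, h2⟩ := mem_Ico_blockIndex hk
    have h3 : θ j ≤ height b s ω j + D := by
      rw [hθ]
      dsimp only
      rw [height_succ]
      linarith [hD (ω j)]
    have h4 := Int.floor_le (θ j)
    have h5 := Int.lt_floor_add_one (θ j)
    have h6 : 0 ≤ (k : ℤ) - ⌊θ j⌋ - Q := by
      have : (0 : ℝ) ≤ k - ⌊θ j⌋ - Q := by linarith
      exact_mod_cast this
    have h7 : (k : ℤ) - ⌊θ j⌋ - Q < D + 1 := by
      have : (k : ℝ) - ⌊θ j⌋ - Q < D + 1 := by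
        change (k : ℝ) < θ j + (Q + D) at h2
        linarith
      exact_mod_cast this
    obtain ⟨i, hi⟩ := Int.eq_ofNat_of_zero_le h6
    have h8 : (k : ℝ) - height b s ω (j + 1) = ((Q + i : ℕ) : ℝ) - Int.fract (θ j) := by
      have : (k : ℝ) - ⌊θ j⌋ - Q = i := by exact_mod_cast hi
      rw [Int.fract]
      push_cast
      linarith
    rw [pow_mul_scale hb hs0, h8]
    exact Finset.single_le_sum (f := fun i : ℕ => Φ ((Q + i : ℕ) : ℝ) (Int.fract (θ j)))
      (fun _ _ => norm_nonneg _) (Finset.mem_range.2 (by omega))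
  set η := ε / (4 * (D + 1)) with hη
  have hDη : D * η ≤ ε / 4 := by
    have : (D : ℝ) * η + η = ε / 4 := by
      rw [hη]
      field_simp
    have : 0 < η := by positivity
    linarith
  have hE := norm_integral_blockSum_le hp hsum hs hr0 hr1 hs0 hT hb hD hμ hg
    (fun j => Finset.sum_nonneg fun _ _ => norm_nonneg _) ω (show 0 < η by positivity) hC
  set Y : ℕ → ℂ := fun j => blockSum b s (Q + D) (fun ω => g (coding s t ω)) j ω with hY
  set E : ℕ → ℂ := fun j => ∫ ω', blockSum b s (Q + D) (fun ω => g (coding s t ω)) j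
    (glue (j + 1) ω ω') ∂(Measure.infinitePi fun _ : ℕ => weightMeasure p) with hEdef
  set u : ℕ → ℝ := fun j => max (‖E j‖ - D * (H Q (Int.fract (θ j)) + η)) 0 with hu
  have hu0 : Tendsto (fun N : ℕ => (N : ℝ)⁻¹ * ∑ j ∈ Finset.range N, u j) atTop (𝓝 0) := by
    refine Tendsto.cesaro (tendsto_const_nhds.congr' ?_)
    filter_upwards [hE] with j hj
    exact (max_eq_right (by linarith)).symm
  have hYE := (hblock Q).norm
  rw [norm_zero] at hYE
  filter_upwards [hu0.eventually_lt_const (show 0 < ε / 4 by positivity),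
    hYE.eventually_lt_const (show 0 < ε / 4 by positivity),
    (hHavg.const_mul (D : ℝ)).eventually_lt_const hQ, eventually_gt_atTop 0] with N h1 h2 h3 hN
  have hN' : (0 : ℝ) < N := by exact_mod_cast hN
  rw [← sum_blockSum hpos (fun ω => g (coding s t ω)) ω N]
  change ‖(N : ℂ)⁻¹ * ∑ j ∈ Finset.range N, (Y j - E j)‖ < _ at h2
  change ‖∑ j ∈ Finset.range N, Y j‖ ≤ _
  rw [norm_mul, norm_inv, Complex.norm_natCast, inv_mul_lt_iff₀ hN'] at h2
  rw [inv_mul_lt_iff₀ hN'] at h1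
  rw [mul_left_comm, inv_mul_lt_iff₀ hN', Finset.mul_sum] at h3
  have h4 : ‖∑ j ∈ Finset.range N, E j‖ ≤ ∑ j ∈ Finset.range N, u j
      + ∑ j ∈ Finset.range N, D * H Q (Int.fract (θ j)) + N * (D * η) := by
    calc _ ≤ ∑ j ∈ Finset.range N, (u j + D * H Q (Int.fract (θ j)) + D * η) :=
          norm_sum_le_of_le _ fun j _ => by
            have := le_max_left (‖E j‖ - D * (H Q (Int.fract (θ j)) + η)) 0
            simp only [hu]
            linarith
      _ = _ := by simp [Finset.sum_add_distrib]
  have h5 := norm_add_le (∑ j ∈ Finset.range N, (Y j - E j)) (∑ j ∈ Finset.range N, E j)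
  rw [← Finset.sum_add_distrib] at h5
  simp only [sub_add_cancel] at h5
  have h6 : N * (D * η) ≤ N * (ε / 4) := mul_le_mul_of_nonneg_left hDη hN'.le
  linarith

end Normality

lemma deriv_ne_zero_of_leftInverse {g h : ℝ → ℝ} (hg : Differentiable ℝ g)
    (hh : Differentiable ℝ h) (hgh : Function.LeftInverse h g) (x : ℝ) : deriv g x ≠ 0 := by
  intro h0
  have h1 := (hh (g x)).hasDerivAt.comp x (hg x).hasDerivAt
  rw [hgh.id, h0, mul_zero] at h1
  exact zero_ne_one (h1.unique (hasDerivAt_id x))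

/-- For a non-atomic self-similar measure `μ` on `ℝ` with some contraction ratio
multiplicatively independent of the integer base `b ≥ 2`, and any `C¹` diffeomorphism
`g : ℝ → ℝ`, the pushforward `g₌μ` is supported on numbers normal in base `b`; equivalently
for `μ`-a.e. `x` the number `g x` is normal in base `b`. -/
theorem stmt1
    (n : ℕ) (s t : Fin n → ℝ)
    (hs : ∀ i, |s i| < 1) (hs0 : ∀ i, s i ≠ 0)
    (p : Fin n → ℝ) (hp : ∀ i, 0 < p i) (hpsum : ∑ i, p i = 1)
    (μ : Measure ℝ) (hprob : IsProbabilityMeasure μ)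
    (hself : μ = ∑ i, ENNReal.ofReal (p i) • Measure.map (fun x => s i * x + t i) μ)
    (hna : ∀ x : ℝ, μ {x} = 0)
    (b : ℕ) (hb : 2 ≤ b)
    (i : Fin n) (hirr : Irrational (Real.log |s i| / Real.log b))
    (g : ℝ → ℝ) (hgbij : Function.Bijective g)
    (hg : ContDiff ℝ 1 g) (hginv : ContDiff ℝ 1 (Function.invFun g)) :
    ∀ᵐ x ∂μ, ∀ f : ℝ → ℝ, Continuous f →
      Tendsto (fun N : ℕ => (N : ℝ)⁻¹ * ∑ k ∈ Finset.range N, f (Int.fract ((b : ℝ) ^ k * g x)))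
        atTop (𝓝 (∫ y in (0:ℝ)..1, f y)) := by
  have : Nonempty (Fin n) := ⟨i⟩
  obtain ⟨i₁, hi₁⟩ := Finite.exists_max fun i => |s i|
  obtain ⟨i₂, hi₂⟩ := Finite.exists_max fun i => |t i|
  have hb1 : (1 : ℝ) < b := by exact_mod_cast (by omega : 1 < b)
  have hμ := map_coding_eq hp hpsum hi₁ (abs_nonneg _) (hs i₁) hi₂ hself
  have hirr' : Irrational (logRatio (b : ℝ) s i) := by
    rw [logRatio, neg_div]
    exact hirr.neg
  have hcm := measurable_coding hi₁ (abs_nonneg _) (hs i₁) hi₂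
  have hweyl : ∀ m : ℤ, m ≠ 0 → ∀ᵐ x ∂μ, Tendsto (fun N : ℕ => (N : ℂ)⁻¹ *
      ∑ k ∈ Finset.range N, unitChar (m * ((b : ℝ) ^ k * g x))) atTop (𝓝 0) := by
    intro m hm
    have hm' : (m : ℝ) ≠ 0 := by exact_mod_cast hm
    have hgm : ContDiff ℝ 1 fun x => (m : ℝ) * g x := contDiff_const.mul hg
    have hgm' : ∀ x, deriv (fun x => (m : ℝ) * g x) x ≠ 0 := fun x => by
      rw [deriv_const_mul _ (hg.differentiable one_ne_zero x)]
      exact mul_ne_zero hm' (deriv_ne_zero_of_leftInverse (hg.differentiable one_ne_zero)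
        (hginv.differentiable one_ne_zero) (Function.leftInverse_invFun hgbij.1) x)
    have h := ae_tendsto_average_unitChar_coding hp hpsum hi₁ (abs_nonneg _) (hs i₁) hs0 hi₂ hb1
      hirr' hna hμ hgm hgm'
    rw [← hμ, ae_map_iff hcm.aemeasurable]
    · filter_upwards [h] with ω hω
      refine hω.congr fun N => ?_
      simp_rw [mul_left_comm]
    · refine measurableSet_tendsto _ fun N => ?_
      have := hg.continuous
      exact (continuous_const.mul (continuous_finsetSum _ fun k _ => by fun_prop)).measurable
  have hall : ∀ᵐ x ∂μ, ∀ m : ℤ, m ≠ 0 → Tendsto (fun N : ℕ => (N : ℂ)⁻¹ *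
      ∑ k ∈ Finset.range N, unitChar (m * ((b : ℝ) ^ k * g x))) atTop (𝓝 0) := by
    refine ae_all_iff.2 fun m => ?_
    by_cases hm : m = 0
    · exact ae_of_all _ fun x h => absurd hm h
    · filter_upwards [hweyl m hm] with x hx _ using hx
  filter_upwards [hall] with x hx f hf
  exact tendsto_average_fract hx hf
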